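/- arXiv:1211.5426 — 2 statements merged into one kernel-verified Lean document; each statement's English description precedes it below -/
import Mathlib

section
/- Let x ∈ (−1,1) be irrational. If Σ_{j=0}^{∞} √(Π_{ℓ=0}^{j−1} |T^ℓ(x)|) < ∞ and Σ_{j=0}^{∞} √(Π_{ℓ=0}^{j−1} |T^ℓ(x)|) · log(1/|T^j(x)|) < ∞ (empty products equal to 1 for j = 0), then the series F_1(x) = Σ_{k=1}^{∞} e^{iπk²x}/k converges and F_1(x) = Σ_{j=0}^{∞} e^{(iπ/4) Σ_{ℓ=0}^{j−1} σ(T^ℓ(x))} √(Π_{ℓ=0}^{j−1} |T^ℓ(x)|) · Ω_1(T^j(x)), the series on the right-hand side being absolutely convergent. -/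
open Complex Filter Finset

noncomputable section

/-- `ρ = e^{iπ/4}`. -/
def ρ : ℂ := Complex.exp (Real.pi * Complex.I / 4)

/-- Partial sum `F_{s,n}(x,t) = Σ_{k=1}^{n} e^{iπk²x + 2πikt}/k^s`. -/
def Fpart (s : ℝ) (n : ℕ) (x t : ℝ) : ℂ :=
  ∑ k ∈ Finset.Icc 1 n,
    Complex.exp (Real.pi * Complex.I * (k : ℂ) ^ 2 * (x : ℂ)
        + 2 * Real.pi * Complex.I * (k : ℂ) * (t : ℂ)) / (k : ℂ) ^ (s : ℂ)

/-- The function `I_s(x,t)` (for `x > 0`). -/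
def Ifun (s x t : ℝ) : ℂ :=
  (∫ u : ℝ, ρ *
      (Complex.exp (Real.pi * Complex.I * ((1 : ℂ) / 2 + ρ * (u : ℂ)) ^ 2 * (x : ℂ)
            + 2 * Real.pi * Complex.I * ((1 : ℂ) / 2 + ρ * (u : ℂ)) * (Int.fract t : ℝ)) /
        (((1 : ℂ) / 2 + ρ * (u : ℂ)) ^ (s : ℂ) *
          (1 - Complex.exp (2 * Real.pi * Complex.I * ((1 : ℂ) / 2 + ρ * (u : ℂ)))))))
  + ρ * (x : ℂ) ^ (s : ℂ) *
    ∫ u : ℝ, (Real.exp (-(Real.pi * x * u ^ 2)) : ℝ) *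
      ∑' k : ℕ, Complex.exp (-(Real.pi * Complex.I * (((k : ℂ) + 1) - (Int.fract t : ℝ)) ^ 2 / (x : ℂ))) *
        (((ρ * (x : ℂ) * (u : ℂ) + ((k : ℂ) + 1) - (Int.fract t : ℝ)) ^ (s : ℂ))⁻¹
          - (((k : ℂ) + 1) ^ (s : ℂ))⁻¹)

/-- `Ω_s(x,t)`. -/
def Omega (s x t : ℝ) : ℂ :=
  if 0 < x then Ifun s x t else (starRingEnd ℂ) (Ifun s (-x) (-t))

/-- `Ω_s(x) = Ω_s(x,0)`. -/
def Omega0 (s x : ℝ) : ℂ := Omega s x 0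

/-- The map `T(x) = -1/x mod 2`, valued in `(-1,1]`. -/
def Tmap (x : ℝ) : ℝ := -1 / x - 2 * ⌈((-1 / x) - 1) / 2⌉

/-- Denominator `Q_n` of the `n`-th convergent of the regular continued fraction of `x`. -/
def Qden (x : ℝ) (n : ℕ) : ℝ := (GenContFract.of x).dens n

end

open scoped Topology

lemma rho_eq : ρ = ((√2 / 2 : ℝ) : ℂ) + ((√2 / 2 : ℝ) : ℂ) * I := by
  rw [ρ, show (Real.pi : ℂ) * I / 4 = ((Real.pi / 4 : ℝ) : ℂ) * I by push_cast; ring,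
    Complex.exp_mul_I, ← Complex.ofReal_cos, ← Complex.ofReal_sin, Real.cos_pi_div_four,
    Real.sin_pi_div_four]

lemma rho_sq : ρ ^ 2 = I := by
  rw [ρ, ← Complex.exp_nat_mul,
    show ((2 : ℕ) : ℂ) * (Real.pi * I / 4) = Real.pi / 2 * I by push_cast; ring,
    Complex.exp_pi_div_two_mul_I]

lemma rho_ne_zero : ρ ≠ 0 := Complex.exp_ne_zero _

lemma norm_rho : ‖ρ‖ = 1 := by
  rw [ρ, show (Real.pi : ℂ) * I / 4 = ((Real.pi / 4 : ℝ) : ℂ) * I by push_cast; ring]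
  exact Complex.norm_exp_ofReal_mul_I _

lemma rho_re : ρ.re = √2 / 2 := by simp [rho_eq]

lemma rho_im : ρ.im = √2 / 2 := by simp [rho_eq]

lemma line_re (a u : ℝ) : ((a : ℂ) + ρ * u).re = a + √2 / 2 * u := by
  simp [rho_re]

lemma line_im (a u : ℝ) : ((a : ℂ) + ρ * u).im = √2 / 2 * u := by
  simp [rho_im]

/-- The closed strip swept by the lines `a' + ρ ℝ`, `a ≤ a' ≤ b`. -/
def tiltedStrip (a b : ℝ) : Set ℂ := {z | a ≤ z.re - z.im ∧ z.re - z.im ≤ b}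

lemma line_mem_tiltedStrip {a b c : ℝ} (hc : c ∈ Set.Icc a b) (u : ℝ) :
    (c : ℂ) + ρ * u ∈ tiltedStrip a b := by
  simp only [tiltedStrip, Set.mem_ofPred_eq, line_re, line_im]
  constructor <;> linarith [hc.1, hc.2]

lemma continuous_line (a : ℝ) : Continuous fun u : ℝ => (a : ℂ) + ρ * u := by fun_prop

lemma continuous_comp_line {φ : ℂ → ℂ} {a b c : ℝ} (hc : c ∈ Set.Icc a b)
    (hφ : ContinuousOn φ (tiltedStrip a b)) : Continuous fun u : ℝ => φ (c + ρ * u) :=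
  hφ.comp_continuous (continuous_line c) (line_mem_tiltedStrip hc)

lemma integrable_of_gaussian_bound {f : ℝ → ℂ} (hf : Continuous f) {K c : ℝ} (hc : 0 < c)
    (hb : ∀ u, ‖f u‖ ≤ K * Real.exp (-c * u ^ 2)) : MeasureTheory.Integrable f :=
  ((integrable_exp_neg_mul_sq hc).const_mul K).mono' hf.aestronglyMeasurable
    (Eventually.of_forall hb)

lemma rotated_eq_line (b u v : ℝ) :
    (b : ℂ) + ρ * (u + v * I) = ((b - √2 * v : ℝ) : ℂ) + ρ * ((u + v : ℝ) : ℂ) := by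
  rw [rho_eq]
  push_cast
  have h : (I : ℂ) ^ 2 = -1 := Complex.I_sq
  linear_combination (√2 / 2 * v : ℂ) * h

/-- Translating the line of integration within a strip of holomorphy. -/
lemma integral_line_eq_of_gaussian_bound {φ : ℂ → ℂ} {a b K c : ℝ} (hab : a ≤ b) (hc : 0 < c)
    (hφ : DifferentiableOn ℂ φ (tiltedStrip a b))
    (hb : ∀ a' ∈ Set.Icc a b, ∀ u : ℝ, ‖φ (a' + ρ * u)‖ ≤ K * Real.exp (-c * u ^ 2)) :
    ∫ u : ℝ, φ (a + ρ * u) = ∫ u : ℝ, φ (b + ρ * u) := by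
  have h2 : (0 : ℝ) < √2 := by positivity
  have hK : 0 ≤ K := by
    have := (norm_nonneg _).trans (hb a ⟨le_rfl, hab⟩ 0)
    simpa using this
  set V : ℝ := (b - a) / √2 with hV
  have hV0 : 0 ≤ V := div_nonneg (by linarith) h2.le
  have hVa : b - √2 * V = a := by rw [hV]; field_simp; ring
  set ψ : ℂ → ℂ := fun w => φ (b + ρ * w) with hψ
  have hmem : ∀ v ∈ Set.Icc 0 V, b - √2 * v ∈ Set.Icc a b := fun v hv =>
    ⟨by rw [← hVa]; have := mul_le_mul_of_nonneg_left hv.2 h2.le; linarith,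
      by have := mul_nonneg h2.le hv.1; linarith⟩
  have hψb : ∀ v ∈ Set.Icc 0 V, ∀ u : ℝ,
      ‖ψ (u + v * I)‖ ≤ K * Real.exp (c * V ^ 2) * Real.exp (-(c / 2) * u ^ 2) := by
    intro v hv u
    simp only [hψ]
    rw [rotated_eq_line]
    refine (hb _ (hmem v hv) _).trans ?_
    rw [mul_assoc, ← Real.exp_add]
    refine mul_le_mul_of_nonneg_left (Real.exp_le_exp.2 ?_) hK
    have h1 : v ^ 2 ≤ V ^ 2 := pow_le_pow_left₀ hv.1 hv.2 2
    nlinarith [mul_nonneg hc.le (sq_nonneg (u + 2 * v)), mul_nonneg hc.le (sub_nonneg.2 h1)]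
  have hψd : ∀ R : ℝ, DifferentiableOn ℂ ψ (Set.uIcc (-R) R ×ℂ Set.uIcc 0 V) := by
    intro R
    refine hφ.comp (by fun_prop) ?_
    intro w hw
    have hv := hw.2
    rw [Set.mem_preimage, Set.uIcc_of_le hV0] at hv
    have := line_mem_tiltedStrip (hmem _ hv) (w.re + w.im)
    rwa [← rotated_eq_line, Complex.re_add_im] at this
  have hrect : ∀ R : ℝ, (∫ u in (-R)..R, ψ (u + (0 : ℝ) * I)) - ∫ u in (-R)..R, ψ (u + V * I)
      = I * (∫ v in (0 : ℝ)..V, ψ ((-R : ℝ) + v * I)) - I * ∫ v in (0 : ℝ)..V, ψ (R + v * I) := by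
    intro R
    have := Complex.integral_boundary_rect_eq_zero_of_differentiableOn ψ ⟨-R, 0⟩ ⟨R, V⟩ (hψd R)
    simp only [smul_eq_mul] at this
    linear_combination this
  have hside : ∀ R : ℝ, ‖∫ v in (0 : ℝ)..V, ψ (R + v * I)‖ ≤
      K * Real.exp (c * V ^ 2) * Real.exp (-(c / 2) * R ^ 2) * |V - 0| := by
    intro R
    refine intervalIntegral.norm_integral_le_of_norm_le_const fun v hv => ?_
    rw [Set.uIoc_of_le hV0] at hv
    exact hψb v ⟨hv.1.le, hv.2⟩ R
  have hexp : Tendsto (fun R : ℝ => K * Real.exp (c * V ^ 2) * Real.exp (-(c / 2) * R ^ 2) * |V - 0|)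
      atTop (𝓝 0) := by
    have h1 : Tendsto (fun R : ℝ => Real.exp (-(c / 2) * R ^ 2)) atTop (𝓝 0) := by
      refine Real.tendsto_exp_atBot.comp ?_
      exact (tendsto_pow_atTop two_ne_zero).const_mul_atTop_of_neg (by linarith)
    simpa using (h1.const_mul (K * Real.exp (c * V ^ 2))).mul_const |V - 0|
  have hR : Tendsto (fun R : ℝ => ∫ v in (0 : ℝ)..V, ψ (R + v * I)) atTop (𝓝 0) :=
    squeeze_zero_norm hside hexp
  have hL : Tendsto (fun R : ℝ => ∫ v in (0 : ℝ)..V, ψ ((-R : ℝ) + v * I)) atTop (𝓝 0) := by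
    refine squeeze_zero_norm (fun R => ?_) hexp
    simpa using hside (-R)
  have hdiff : Tendsto (fun R : ℝ => (∫ u in (-R)..R, ψ (u + (0 : ℝ) * I))
      - ∫ u in (-R)..R, ψ (u + V * I)) atTop (𝓝 0) := by
    simp_rw [hrect]
    simpa using (hL.const_mul I).sub (hR.const_mul I)
  have hint : ∀ v ∈ Set.Icc 0 V, MeasureTheory.Integrable fun u : ℝ => ψ (u + v * I) := by
    intro v hv
    refine integrable_of_gaussian_bound ?_ (half_pos hc) (hψb v hv)
    have h1 := (continuous_comp_line (hmem v hv) hφ.continuousOn).comp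
      (show Continuous fun u : ℝ => u + v by fun_prop)
    refine h1.congr fun u => ?_
    simp only [hψ, rotated_eq_line, Function.comp]
  have hlim : Tendsto (fun R : ℝ => (∫ u in (-R)..R, ψ (u + (0 : ℝ) * I))
      - ∫ u in (-R)..R, ψ (u + V * I)) atTop
      (𝓝 ((∫ u : ℝ, ψ (u + (0 : ℝ) * I)) - ∫ u : ℝ, ψ (u + V * I))) :=
    (MeasureTheory.intervalIntegral_tendsto_integral (hint 0 ⟨le_rfl, hV0⟩)
      tendsto_neg_atTop_atBot tendsto_id).sub
    (MeasureTheory.intervalIntegral_tendsto_integral (hint V ⟨hV0, le_rfl⟩)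
      tendsto_neg_atTop_atBot tendsto_id)
  have heq := sub_eq_zero.1 (tendsto_nhds_unique hlim hdiff)
  have hV' : ∫ u : ℝ, ψ (u + V * I) = ∫ u : ℝ, φ (a + ρ * u) := by
    rw [← MeasureTheory.integral_add_right_eq_self (fun u : ℝ => φ (a + ρ * u)) V]
    simp only [hψ, rotated_eq_line, hVa]
  rw [← hV', ← heq]
  simp [hψ]

lemma exists_gaussian_bound {φ : ℂ → ℂ} {a b K c : ℝ} (hc : 0 < c)
    (hφ : ContinuousOn φ (tiltedStrip a b))
    (hb : ∀ a' ∈ Set.Icc a b, ∀ u : ℝ, 1 ≤ |u| → ‖φ (a' + ρ * u)‖ ≤ K * Real.exp (-c * u ^ 2)) :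
    ∃ K', ∀ a' ∈ Set.Icc a b, ∀ u : ℝ, ‖φ (a' + ρ * u)‖ ≤ K' * Real.exp (-c * u ^ 2) := by
  have hcomp : IsCompact (Set.Icc a b ×ˢ Set.Icc (-1 : ℝ) 1) := isCompact_Icc.prod isCompact_Icc
  have hcont : ContinuousOn (fun p : ℝ × ℝ => φ (p.1 + ρ * p.2))
      (Set.Icc a b ×ˢ Set.Icc (-1 : ℝ) 1) :=
    hφ.comp (Continuous.continuousOn (by fun_prop)) fun p hp => line_mem_tiltedStrip hp.1 _
  obtain ⟨M, hM⟩ := hcomp.exists_bound_of_continuousOn hcont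
  refine ⟨max K (M * Real.exp c), fun a' ha' u => ?_⟩
  rcases le_or_gt 1 |u| with hu | hu
  · exact (hb a' ha' u hu).trans
      (mul_le_mul_of_nonneg_right (le_max_left _ _) (Real.exp_pos _).le)
  · have h1 := hM (a', u) ⟨ha', abs_le.1 hu.le⟩
    have hM0 : 0 ≤ M := (norm_nonneg _).trans h1
    calc ‖φ (a' + ρ * u)‖ ≤ M * 1 := by simpa using h1
      _ ≤ M * (Real.exp c * Real.exp (-c * u ^ 2)) := by
          refine mul_le_mul_of_nonneg_left ?_ hM0
          rw [← Real.exp_add, Real.one_le_exp_iff]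
          have : u ^ 2 ≤ 1 := (sq_le_one_iff_abs_le_one u).2 hu.le
          nlinarith
      _ = M * Real.exp c * Real.exp (-c * u ^ 2) := by ring
      _ ≤ _ := mul_le_mul_of_nonneg_right (le_max_right _ _) (Real.exp_pos _).le

/-- The Gaussian `exp (iπ (x z² + b z))`. -/
noncomputable def quadExp (x b : ℝ) (z : ℂ) : ℂ := Complex.exp (Real.pi * I * (x * z ^ 2 + b * z))

lemma differentiable_quadExp (x b : ℝ) : Differentiable ℂ (quadExp x b) := by
  unfold quadExp; fun_prop

lemma norm_quadExp_line (x b a u : ℝ) : ‖quadExp x b (a + ρ * u)‖ =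
    Real.exp (-Real.pi * (x * u ^ 2 + √2 * x * a * u + √2 / 2 * b * u)) := by
  rw [quadExp, Complex.norm_exp]
  congr 1
  have e : (Real.pi : ℂ) * I * (x * (a + ρ * u) ^ 2 + b * (a + ρ * u)) =
      ((Real.pi * (x * (a ^ 2 + √2 * a * u) + b * (a + √2 / 2 * u)) : ℝ) : ℂ) * I
      + ((-Real.pi * (x * u ^ 2 + √2 * x * a * u + √2 / 2 * b * u) : ℝ) : ℂ) := by
    rw [show ((a : ℂ) + ρ * u) ^ 2 = a ^ 2 + 2 * a * ρ * u + ρ ^ 2 * u ^ 2 by ring, rho_sq,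
      rho_eq]
    push_cast
    linear_combination (Real.pi * x * u ^ 2 + Real.pi * x * √2 * a * u
      + Real.pi * b * √2 / 2 * u : ℂ) * Complex.I_sq
  rw [e, Complex.add_re, Complex.re_ofReal_mul, Complex.I_re, mul_zero, zero_add,
    Complex.ofReal_re]

lemma exists_norm_quadExp_line_le {x : ℝ} (hx : 0 < x) (b A : ℝ) : ∃ K : ℝ, 0 < K ∧
    ∀ a u : ℝ, |a| ≤ A → ‖quadExp x b (a + ρ * u)‖ ≤ K * Real.exp (-(Real.pi * x / 2) * u ^ 2) := by
  set M : ℝ := √2 * x * A + √2 / 2 * |b| with hM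
  refine ⟨Real.exp (Real.pi * (M ^ 2 / (2 * x))), Real.exp_pos _, fun a u ha => ?_⟩
  have hA : 0 ≤ A := (abs_nonneg a).trans ha
  rw [norm_quadExp_line, ← Real.exp_add]
  refine Real.exp_le_exp.2 ?_
  have hM1 : |√2 * x * a + √2 / 2 * b| ≤ M := by
    refine (abs_add_le _ _).trans ?_
    rw [abs_mul (√2 * x), abs_mul (√2 / 2), abs_of_pos (by positivity : (0 : ℝ) < √2 * x),
      abs_of_pos (by positivity : (0 : ℝ) < √2 / 2), hM]
    gcongr
  have h1 : -((√2 * x * a + √2 / 2 * b) * u) ≤ M * |u| :=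
    (neg_le_abs _).trans (by rw [abs_mul]; gcongr)
  have h2 : M * |u| ≤ M ^ 2 / (2 * x) + x / 2 * u ^ 2 := by
    have : M ^ 2 / (2 * x) + x / 2 * u ^ 2 - M * |u| = (M - x * |u|) ^ 2 / (2 * x) := by
      rw [← sq_abs u]; field_simp; ring
    have h3 : 0 ≤ (M - x * |u|) ^ 2 / (2 * x) := by positivity
    linarith
  nlinarith [Real.pi_pos, mul_le_mul_of_nonneg_left (h1.trans h2) Real.pi_pos.le]

lemma half_le_norm_line (a u : ℝ) : a / 2 ≤ ‖(a : ℂ) + ρ * u‖ := by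
  have h1 := Complex.abs_re_le_norm ((a : ℂ) + ρ * u)
  have h2 := Complex.abs_im_le_norm ((a : ℂ) + ρ * u)
  rw [line_re] at h1
  rw [line_im] at h2
  linarith [(abs_le.1 h1).2, (abs_le.1 h1).1, (abs_le.1 h2).2, (abs_le.1 h2).1,
    le_abs_self (a + √2 / 2 * u), neg_le_abs (√2 / 2 * u)]

lemma line_ne_zero {a : ℝ} (ha : 0 < a) (u : ℝ) : (a : ℂ) + ρ * u ≠ 0 :=
  norm_pos_iff.1 ((half_pos ha).trans_le (half_le_norm_line a u))

/-- The denominator `1 - exp (2πi z)`. -/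
noncomputable def oneSubExp (z : ℂ) : ℂ := 1 - Complex.exp (2 * Real.pi * I * z)

lemma differentiable_oneSubExp : Differentiable ℂ oneSubExp := by
  unfold oneSubExp; fun_prop

lemma norm_exp_line (a u : ℝ) :
    ‖Complex.exp (2 * Real.pi * I * (a + ρ * u))‖ = Real.exp (-(√2 * Real.pi * u)) := by
  have := norm_quadExp_line 0 2 a u
  rw [quadExp] at this
  convert this using 2
  · congr 1; push_cast; ring
  · ring

lemma one_le_sqrt_two_mul_pi : 1 ≤ √2 * Real.pi :=
  one_le_mul_of_one_le_of_one_le (Real.one_le_sqrt.2 (by norm_num))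
    (by linarith [Real.pi_gt_three])

lemma half_le_norm_oneSubExp {a u : ℝ} (hu : 1 ≤ |u|) : 1 / 2 ≤ ‖oneSubExp (a + ρ * u)‖ := by
  have h1 := one_le_sqrt_two_mul_pi
  have hw := norm_exp_line a u
  rcases le_abs.1 hu with h | h
  · have h3 := norm_sub_norm_le 1 (Complex.exp (2 * Real.pi * I * (a + ρ * u)))
    have h4 : Real.exp (-(√2 * Real.pi * u)) ≤ 1 / 2 := by
      rw [Real.exp_neg, one_div]
      refine inv_anti₀ two_pos ?_
      have := Real.add_one_le_exp (√2 * Real.pi * u)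
      nlinarith
    rw [hw, norm_one] at h3
    exact le_trans (by linarith) h3
  · have h3 := norm_sub_norm_le (Complex.exp (2 * Real.pi * I * (a + ρ * u))) 1
    have h4 := Real.add_one_le_exp (-(√2 * Real.pi * u))
    rw [hw, norm_one, norm_sub_rev] at h3
    refine le_trans ?_ h3
    nlinarith

lemma half_le_norm_one_add_exp (y : ℝ) :
    1 / 2 ≤ ‖1 + Complex.exp (y * (I - 1))‖ ∧
      Real.exp (-y) / 2 ≤ ‖1 + Complex.exp (y * (I - 1))‖ := by
  set q : ℂ := Complex.exp (y * (I - 1)) with hq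
  have hn : ‖q‖ = Real.exp (-y) := by rw [hq, Complex.norm_exp]; simp
  rcases le_or_gt |y| (Real.pi / 2) with hy | hy
  · have hre : 0 ≤ q.re := by
      rw [hq, Complex.exp_re]
      refine mul_nonneg (Real.exp_pos _).le (Real.cos_nonneg_of_mem_Icc ?_)
      simpa using abs_le.1 hy
    have h1 : ‖1 + q‖ ^ 2 = 1 + 2 * q.re + ‖q‖ ^ 2 := by
      rw [Complex.sq_norm, Complex.sq_norm, Complex.normSq_apply, Complex.normSq_apply]
      simp; ring
    rw [← hn]
    constructor
    · nlinarith [norm_nonneg (1 + q), norm_nonneg q]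
    · nlinarith [norm_nonneg (1 + q), norm_nonneg q]
  · have h1 : 1 < |y| := by linarith [Real.pi_gt_three]
    have a1 : 1 - ‖q‖ ≤ ‖1 + q‖ := by simpa using norm_sub_norm_le 1 (-q)
    have a2 : ‖q‖ - 1 ≤ ‖1 + q‖ := by simpa [add_comm] using norm_sub_norm_le q (-1)
    rw [hn] at a1 a2
    rcases lt_abs.1 h1 with h | h
    · have h4 : Real.exp (-y) ≤ 1 / 2 := by
        rw [Real.exp_neg, one_div]
        refine inv_anti₀ two_pos ?_
        linarith [Real.add_one_le_exp y]
      constructor <;> linarith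
    · have h4 := Real.add_one_le_exp (-y)
      constructor <;> linarith

lemma oneSubExp_half_integer (n : ℕ) (u : ℝ) :
    oneSubExp (((n + 1 / 2 : ℝ) : ℂ) + ρ * u) =
      1 + Complex.exp (((√2 * Real.pi * u : ℝ) : ℂ) * (I - 1)) := by
  rw [oneSubExp, show 2 * (Real.pi : ℂ) * I * (((n + 1 / 2 : ℝ) : ℂ) + ρ * u) =
    n * (2 * Real.pi * I) + (Real.pi * I + ((√2 * Real.pi * u : ℝ) : ℂ) * (I - 1)) by
      rw [rho_eq]; push_cast
      linear_combination (√2 * Real.pi * u : ℂ) * Complex.I_sq,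
    Complex.exp_add, Complex.exp_nat_mul_two_pi_mul_I, Complex.exp_add, Complex.exp_pi_mul_I]
  ring

lemma half_le_norm_oneSubExp_half_integer (n : ℕ) (u : ℝ) :
    1 / 2 ≤ ‖oneSubExp (((n + 1 / 2 : ℝ) : ℂ) + ρ * u)‖ ∧
      Real.exp (-(√2 * Real.pi * u)) / 2 ≤ ‖oneSubExp (((n + 1 / 2 : ℝ) : ℂ) + ρ * u)‖ := by
  rw [oneSubExp_half_integer]
  exact half_le_norm_one_add_exp _

lemma oneSubExp_half_integer_ne_zero (n : ℕ) (u : ℝ) :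
    oneSubExp (((n + 1 / 2 : ℝ) : ℂ) + ρ * u) ≠ 0 := by
  have := (half_le_norm_oneSubExp_half_integer n u).1
  intro h
  rw [h, norm_zero] at this
  norm_num at this

lemma oneSubExp_eq_zero_iff {z : ℂ} : oneSubExp z = 0 ↔ ∃ m : ℤ, z = m := by
  rw [oneSubExp, sub_eq_zero, eq_comm, Complex.exp_eq_one_iff]
  refine exists_congr fun m => ?_
  rw [show 2 * (Real.pi : ℂ) * I * z = z * (2 * Real.pi * I) by ring]
  exact mul_left_inj' Complex.two_pi_I_ne_zero

lemma integrable_div_oneSubExp {f : ℝ → ℂ} (hf : Continuous f) {K c : ℝ} (hc : 0 < c)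
    (hb : ∀ u, ‖f u‖ ≤ K * Real.exp (-c * u ^ 2)) (n : ℕ) :
    MeasureTheory.Integrable fun u : ℝ => f u / oneSubExp (((n + 1 / 2 : ℝ) : ℂ) + ρ * u) := by
  refine integrable_of_gaussian_bound (K := K * 2) (c := c) ?_ hc fun u => ?_
  · exact hf.div (differentiable_oneSubExp.continuous.comp (continuous_line _))
      (oneSubExp_half_integer_ne_zero n)
  · rw [norm_div, div_eq_mul_inv, mul_right_comm]
    have h := (half_le_norm_oneSubExp_half_integer n u).1
    refine mul_le_mul (hb u) ?_ (by positivity) ((norm_nonneg _).trans (hb u))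
    exact inv_le_of_inv_le₀ two_pos (by simpa using h)

/-- A simple pole at `k` crossed by the line of integration contributes nothing when the
numerator vanishes there. -/
lemma integral_div_oneSubExp_eq {h : ℂ → ℂ} {K c : ℝ} (hc : 0 < c) (n : ℕ)
    (hh : DifferentiableOn ℂ h (tiltedStrip (n + 1 / 2) ((n + 1 : ℕ) + 1 / 2)))
    (hb : ∀ a ∈ Set.Icc (n + 1 / 2 : ℝ) ((n + 1 : ℕ) + 1 / 2), ∀ u : ℝ,
      ‖h (a + ρ * u)‖ ≤ K * Real.exp (-c * u ^ 2))
    (h0 : h ((n + 1 : ℕ) : ℂ) = 0) :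
    ∫ u : ℝ, h (((n + 1 / 2 : ℝ) : ℂ) + ρ * u) / oneSubExp (((n + 1 / 2 : ℝ) : ℂ) + ρ * u) =
    ∫ u : ℝ, h ((((n + 1 : ℕ) + 1 / 2 : ℝ) : ℂ) + ρ * u) /
      oneSubExp ((((n + 1 : ℕ) + 1 / 2 : ℝ) : ℂ) + ρ * u) := by
  set k : ℕ := n + 1 with hk
  set S := tiltedStrip (n + 1 / 2) (k + 1 / 2) with hS
  have hkn : (k : ℝ) = n + 1 := by rw [hk]; push_cast; ring
  have hnhds : S ∈ 𝓝 (k : ℂ) := by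
    have hc1 : Continuous fun z : ℂ => z.re - z.im := by fun_prop
    have : (fun z : ℂ => z.re - z.im) ⁻¹' Set.Ioo (n + 1 / 2 : ℝ) (k + 1 / 2) ∈ 𝓝 (k : ℂ) := by
      refine (isOpen_Ioo.preimage hc1).mem_nhds ?_
      simp only [Set.mem_preimage, Complex.natCast_re, Complex.natCast_im, Set.mem_Ioo]
      constructor <;> linarith
    exact Filter.mem_of_superset this fun z hz => ⟨hz.1.le, hz.2.le⟩
  set φ : ℂ → ℂ := fun z => dslope h k z / dslope oneSubExp k z with hφ
  have hk0 : oneSubExp (k : ℂ) = 0 := oneSubExp_eq_zero_iff.2 ⟨k, by simp⟩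
  have hφ_eq : ∀ z : ℂ, z ≠ k → φ z = h z / oneSubExp z := by
    intro z hz
    simp only [hφ]
    rw [dslope_of_ne _ hz, dslope_of_ne _ hz, slope_def_field, slope_def_field, h0, hk0, sub_zero,
      sub_zero, div_div_div_cancel_right₀ (sub_ne_zero.2 hz)]
  have hden : ∀ z ∈ S, dslope oneSubExp k z ≠ 0 := by
    intro z hz
    by_cases hzk : z = k
    · rw [hzk, dslope_same]
      have hd : HasDerivAt oneSubExp
          (0 - Complex.exp (2 * Real.pi * I * k) * (2 * Real.pi * I * 1)) (k : ℂ) :=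
        (hasDerivAt_const _ _).sub (((hasDerivAt_id (k : ℂ)).const_mul _).cexp)
      rw [hd.deriv]
      simp [Complex.exp_ne_zero, Real.pi_ne_zero]
    · rw [dslope_of_ne _ hzk, slope_def_field, hk0, sub_zero]
      refine div_ne_zero ?_ (sub_ne_zero.2 hzk)
      intro h1
      obtain ⟨m, rfl⟩ := oneSubExp_eq_zero_iff.1 h1
      apply hzk
      have h2 := hz.1
      have h3 := hz.2
      simp only [Complex.intCast_re, Complex.intCast_im, sub_zero] at h2 h3
      have h4 : (k : ℤ) - 1 < m := by
        have : (((k : ℤ) - 1 : ℤ) : ℝ) < m := by push_cast; linarith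
        exact_mod_cast this
      have h5 : m < (k : ℤ) + 1 := by
        have : (m : ℝ) < ((k + 1 : ℤ) : ℝ) := by push_cast; linarith
        exact_mod_cast this
      have : m = k := by omega
      rw [this]; simp
  have hd : DifferentiableOn ℂ φ S :=
    ((Complex.differentiableOn_dslope hnhds).2 hh).div
      ((Complex.differentiableOn_dslope hnhds).2 differentiable_oneSubExp.differentiableOn) hden
  obtain ⟨K', hK'⟩ := exists_gaussian_bound (K := K * 2) hc hd.continuousOn (by
    intro a ha u hu
    rw [hφ_eq, norm_div, div_eq_mul_inv, mul_right_comm]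
    · refine mul_le_mul (hb a ha u) ?_ (by positivity) ((norm_nonneg _).trans (hb a ha u))
      exact inv_le_of_inv_le₀ two_pos (by simpa using half_le_norm_oneSubExp hu)
    · intro h1
      have h2 := congrArg Complex.im h1
      rw [line_im, Complex.natCast_im] at h2
      have h3 : u = 0 := by
        rcases mul_eq_zero.1 h2 with h3 | h3
        · exact absurd h3 (by positivity)
        · exact h3
      rw [h3] at hu
      norm_num at hu)
  have hkey := integral_line_eq_of_gaussian_bound (by linarith) hc hd hK'
  have hne : ∀ (m : ℕ) (u : ℝ), (((m + 1 / 2 : ℝ) : ℂ) + ρ * u) ≠ k := by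
    intro m u h1
    apply oneSubExp_half_integer_ne_zero m u
    rw [h1, hk0]
  simpa only [hφ_eq _ (hne _ _)] using hkey

lemma quadExp_add_one (z : ℂ) :
    quadExp 1 1 (z + 1) = quadExp 1 1 z * Complex.exp (2 * Real.pi * I * z) := by
  rw [quadExp, quadExp, ← Complex.exp_add]
  refine (congrArg Complex.exp ?_).trans (Complex.exp_periodic _)
  push_cast; ring

lemma oneSubExp_add_one (z : ℂ) : oneSubExp (z + 1) = oneSubExp z := by
  rw [oneSubExp, oneSubExp, mul_add, mul_one, Complex.exp_periodic]

lemma quadExp_natCast (n : ℕ) : quadExp 1 1 n = 1 := by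
  obtain ⟨m, hm⟩ := Nat.even_mul_succ_self n
  have hm' : (n : ℂ) * (n + 1) = m + m := by exact_mod_cast hm
  rw [quadExp, show (Real.pi : ℂ) * I * (((1 : ℝ) : ℂ) * n ^ 2 + ((1 : ℝ) : ℂ) * n) =
    m * (2 * Real.pi * I) by push_cast; linear_combination (Real.pi : ℂ) * I * hm',
    Complex.exp_nat_mul_two_pi_mul_I]

lemma integral_quadExp_line (a : ℝ) : ∫ u : ℝ, ρ * quadExp 1 1 (a + ρ * u) = 1 := by
  have h1 : ∀ u : ℝ, quadExp 1 1 (a + ρ * u) = Complex.exp ((-Real.pi : ℂ) * u ^ 2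
      + (Real.pi * I * ρ * (2 * a + 1)) * u + Real.pi * I * (a ^ 2 + a)) := by
    intro u
    rw [quadExp]
    congr 1
    push_cast
    linear_combination (Real.pi * I * u ^ 2 : ℂ) * rho_sq + (Real.pi * u ^ 2 : ℂ) * Complex.I_sq
  simp_rw [h1]
  have hpi : (Real.pi : ℂ) ≠ 0 := by exact_mod_cast Real.pi_ne_zero
  rw [MeasureTheory.integral_const_mul, integral_cexp_quadratic (by simp [Real.pi_pos]), neg_neg,
    div_self hpi, Complex.one_cpow, one_mul, ρ, ← Complex.exp_add]
  refine (congrArg Complex.exp ?_).trans Complex.exp_zero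
  have h2 : ((Real.pi : ℂ) * I * ρ * (2 * a + 1)) ^ 2 / (4 * -Real.pi) =
      Real.pi * I * (2 * a + 1) ^ 2 / 4 := by
    rw [show ((Real.pi : ℂ) * I * ρ * (2 * a + 1)) ^ 2 =
      Real.pi ^ 2 * I ^ 2 * ρ ^ 2 * (2 * a + 1) ^ 2 by ring, rho_sq, Complex.I_sq]
    field_simp
  rw [ρ] at h2
  rw [h2]; ring

/-- The integral of `e^{iπxz²} / (z (1 - e^{2πiz}))` over the line `a + ρ ℝ`. -/
noncomputable def lineIntegral (x a : ℝ) : ℂ :=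
  ∫ u : ℝ, ρ * (quadExp x 0 (a + ρ * u) / (a + ρ * u) / oneSubExp (a + ρ * u))

lemma integral_quadExp_div_oneSubExp_sub (n : ℕ) :
    (∫ u : ℝ, quadExp 1 1 (((n + 1 / 2 : ℝ) : ℂ) + ρ * u) /
        oneSubExp (((n + 1 / 2 : ℝ) : ℂ) + ρ * u)) -
      (∫ u : ℝ, quadExp 1 1 ((((n + 1 : ℕ) + 1 / 2 : ℝ) : ℂ) + ρ * u) /
        oneSubExp ((((n + 1 : ℕ) + 1 / 2 : ℝ) : ℂ) + ρ * u)) = ρ⁻¹ := by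
  obtain ⟨K, -, hK⟩ := exists_norm_quadExp_line_le one_pos 1 (n + 2)
  have hc : 0 < Real.pi * 1 / 2 := by positivity
  have hint : ∀ m : ℕ, m ≤ n + 1 → MeasureTheory.Integrable fun u : ℝ =>
      quadExp 1 1 (((m + 1 / 2 : ℝ) : ℂ) + ρ * u) /
        oneSubExp (((m + 1 / 2 : ℝ) : ℂ) + ρ * u) := by
    intro m hm
    have hm' : (m : ℝ) ≤ n + 1 := by exact_mod_cast hm
    refine integrable_div_oneSubExp
      ((differentiable_quadExp 1 1).continuous.comp (continuous_line _)) hc (fun u => hK _ u ?_) m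
    rw [abs_of_nonneg (by positivity)]
    linarith
  rw [← MeasureTheory.integral_sub (hint n (by omega)) (hint (n + 1) le_rfl)]
  refine eq_inv_of_mul_eq_one_right ?_
  rw [← MeasureTheory.integral_const_mul, ← integral_quadExp_line (n + 1 / 2)]
  congr 1
  ext u
  congr 1
  rw [show ((((n + 1 : ℕ) + 1 / 2 : ℝ) : ℂ) + ρ * u) = ((n + 1 / 2 : ℝ) : ℂ) + ρ * u + 1 by
    push_cast; ring, quadExp_add_one, oneSubExp_add_one, ← sub_div,
    div_eq_iff (oneSubExp_half_integer_ne_zero n u), oneSubExp]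
  ring

lemma exists_norm_quadExp_div_line_le {x : ℝ} (hx : 0 < x) (b : ℝ) {a₀ A : ℝ} (ha₀ : 0 < a₀) :
    ∃ K : ℝ, 0 < K ∧ ∀ a ∈ Set.Icc a₀ A, ∀ u : ℝ,
      ‖quadExp x b (a + ρ * u) / (a + ρ * u)‖ ≤ K * Real.exp (-(Real.pi * x / 2) * u ^ 2) := by
  obtain ⟨K, hK0, hK⟩ := exists_norm_quadExp_line_le hx b A
  refine ⟨K * (a₀ / 2)⁻¹, by positivity, fun a ha u => ?_⟩
  rw [norm_div, div_eq_mul_inv, mul_right_comm]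
  have h1 := hK a u (by rw [abs_of_pos (ha₀.trans_le ha.1)]; exact ha.2)
  have h2 : a₀ / 2 ≤ ‖(a : ℂ) + ρ * u‖ :=
    (by linarith [ha.1] : a₀ / 2 ≤ a / 2).trans (half_le_norm_line a u)
  exact mul_le_mul h1 (inv_anti₀ (by positivity) h2) (by positivity) (by positivity)

lemma differentiableOn_quadExp_div (x b : ℝ) {a₀ A : ℝ} (ha₀ : 0 < a₀) :
    DifferentiableOn ℂ (fun z => quadExp x b z / z) (tiltedStrip a₀ A) := by
  refine (differentiable_quadExp x b).differentiableOn.div differentiableOn_id ?_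
  intro z hz h
  change z = 0 at h
  have := hz.1
  rw [h] at this
  simp at this
  linarith

lemma lineIntegral_sub {x : ℝ} (hx : 0 < x) (n : ℕ) :
    lineIntegral x (n + 1 / 2) - lineIntegral x ((n + 1 : ℕ) + 1 / 2) =
      quadExp x 0 ((n + 1 : ℕ) : ℂ) / ((n + 1 : ℕ) : ℂ) := by
  set v : ℂ := quadExp x 0 ((n + 1 : ℕ) : ℂ) / ((n + 1 : ℕ) : ℂ) with hv
  have ha₀ : (0 : ℝ) < n + 1 / 2 := by positivity
  obtain ⟨K₁, hK₁0, hK₁⟩ := exists_norm_quadExp_div_line_le (A := (n + 1 : ℕ) + 1 / 2) hx 0 ha₀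
  obtain ⟨K₂, hK₂0, hK₂⟩ := exists_norm_quadExp_line_le one_pos 1 ((n + 1 : ℕ) + 1 / 2)
  set c : ℝ := min (Real.pi * x / 2) (Real.pi * 1 / 2) with hc
  have hc0 : 0 < c := lt_min (by positivity) (by positivity)
  have hK₁' : ∀ a ∈ Set.Icc (n + 1 / 2 : ℝ) ((n + 1 : ℕ) + 1 / 2), ∀ u : ℝ,
      ‖quadExp x 0 (a + ρ * u) / (a + ρ * u)‖ ≤ K₁ * Real.exp (-c * u ^ 2) := fun a ha u =>
    (hK₁ a ha u).trans <| mul_le_mul_of_nonneg_left (Real.exp_le_exp.2 <|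
      mul_le_mul_of_nonneg_right (neg_le_neg (min_le_left _ _)) (sq_nonneg u)) hK₁0.le
  have hK₂' : ∀ a ∈ Set.Icc (n + 1 / 2 : ℝ) ((n + 1 : ℕ) + 1 / 2), ∀ u : ℝ,
      ‖quadExp 1 1 (a + ρ * u)‖ ≤ K₂ * Real.exp (-c * u ^ 2) := fun a ha u =>
    (hK₂ a u (by rw [abs_of_pos (ha₀.trans_le ha.1)]; exact ha.2)).trans <|
      mul_le_mul_of_nonneg_left (Real.exp_le_exp.2 <|
        mul_le_mul_of_nonneg_right (neg_le_neg (min_le_right _ _)) (sq_nonneg u)) hK₂0.le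
  have hn1 : ((n + 1 : ℕ) : ℝ) = n + 1 := by push_cast; ring
  have hmem : ∀ m : ℕ, n ≤ m → m ≤ n + 1 →
      (m + 1 / 2 : ℝ) ∈ Set.Icc (n + 1 / 2 : ℝ) ((n + 1 : ℕ) + 1 / 2) := by
    intro m h1 h2
    have h1' : (n : ℝ) ≤ m := by exact_mod_cast h1
    have h2' : (m : ℝ) ≤ (n + 1 : ℕ) := by exact_mod_cast h2
    constructor <;> linarith
  have hkey := integral_div_oneSubExp_eq (h := fun z => quadExp x 0 z / z - v * quadExp 1 1 z)
    (K := K₁ + ‖v‖ * K₂) hc0 n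
    ((differentiableOn_quadExp_div x 0 ha₀).sub
      ((differentiable_quadExp 1 1).differentiableOn.const_mul v))
    (by
      intro a ha u
      refine (norm_sub_le _ _).trans ?_
      rw [norm_mul, add_mul, mul_assoc]
      exact add_le_add (hK₁' a ha u) (mul_le_mul_of_nonneg_left (hK₂' a ha u) (norm_nonneg _)))
    (by simp only [quadExp_natCast, ← hv, mul_one, sub_self])
  simp only [sub_div, mul_div_assoc] at hkey
  have hi₁ : ∀ m : ℕ, n ≤ m → m ≤ n + 1 → MeasureTheory.Integrable fun u : ℝ =>
      quadExp x 0 (((m + 1 / 2 : ℝ) : ℂ) + ρ * u) / (((m + 1 / 2 : ℝ) : ℂ) + ρ * u) /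
        oneSubExp (((m + 1 / 2 : ℝ) : ℂ) + ρ * u) := fun m h1 h2 =>
    integrable_div_oneSubExp (continuous_comp_line (φ := fun z => quadExp x 0 z / z) (hmem m h1 h2)
      (differentiableOn_quadExp_div x 0 ha₀).continuousOn) hc0 (hK₁' _ (hmem m h1 h2)) m
  have hi₂ : ∀ m : ℕ, n ≤ m → m ≤ n + 1 → MeasureTheory.Integrable fun u : ℝ =>
      v * (quadExp 1 1 (((m + 1 / 2 : ℝ) : ℂ) + ρ * u) /
        oneSubExp (((m + 1 / 2 : ℝ) : ℂ) + ρ * u)) := fun m h1 h2 =>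
    (integrable_div_oneSubExp ((differentiable_quadExp 1 1).continuous.comp (continuous_line _))
      hc0 (hK₂' _ (hmem m h1 h2)) m).const_mul v
  rw [MeasureTheory.integral_sub (hi₁ n le_rfl (by omega)) (hi₂ n le_rfl (by omega)),
    MeasureTheory.integral_sub (hi₁ (n + 1) (by omega) le_rfl) (hi₂ (n + 1) (by omega) le_rfl),
    MeasureTheory.integral_const_mul, MeasureTheory.integral_const_mul] at hkey
  have h0 := integral_quadExp_div_oneSubExp_sub n
  rw [lineIntegral, lineIntegral, MeasureTheory.integral_const_mul,
    MeasureTheory.integral_const_mul]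
  linear_combination ρ * hkey + ρ * v * h0 + v * mul_inv_cancel₀ rho_ne_zero

lemma Fpart_one_eq_sum (n : ℕ) (x : ℝ) :
    Fpart 1 n x 0 = ∑ k ∈ Finset.range n, quadExp x 0 ((k + 1 : ℕ) : ℂ) / ((k + 1 : ℕ) : ℂ) := by
  rw [Fpart, Finset.range_eq_Ico, Finset.sum_Ico_add' (fun k : ℕ => quadExp x 0 (k : ℂ) / (k : ℂ))]
  refine Finset.sum_congr (by ext; simp) fun k _ => ?_
  rw [quadExp, Complex.ofReal_one, Complex.cpow_one]
  congr 2
  push_cast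
  ring

lemma Fpart_one_eq_lineIntegral {x : ℝ} (hx : 0 < x) (n : ℕ) :
    Fpart 1 n x 0 = lineIntegral x (1 / 2) - lineIntegral x (n + 1 / 2) := by
  rw [Fpart_one_eq_sum]
  simp_rw [← lineIntegral_sub hx]
  rw [Finset.sum_range_sub' (fun k : ℕ => lineIntegral x (k + 1 / 2))]
  simp

/-- The `k`-th summand of the second integrand in `Ifun 1 x 0`. -/
noncomputable def corrTerm (x : ℝ) (k : ℕ) (u : ℝ) : ℂ :=
  (Real.exp (-(Real.pi * x * u ^ 2)) : ℝ) *
    (Complex.exp (-(Real.pi * I * ((k : ℂ) + 1) ^ 2 / x)) *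
      ((ρ * x * u + ((k : ℂ) + 1))⁻¹ - ((k : ℂ) + 1)⁻¹))

lemma Ifun_one_zero (x : ℝ) : Ifun 1 x 0 =
    lineIntegral x (1 / 2) + ρ * x * ∫ u : ℝ, ∑' k : ℕ, corrTerm x k u := by
  simp only [Ifun, lineIntegral, corrTerm, quadExp, oneSubExp, Int.fract_zero, Complex.ofReal_zero,
    Complex.ofReal_one, Complex.cpow_one, sub_zero, mul_zero, add_zero, zero_mul, tsum_mul_left]
  congr 2
  ext u
  rw [div_div]
  push_cast
  congr 3
  ring

lemma line_shift_eq {x : ℝ} (k : ℕ) (u : ℝ) :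
    ρ * x * u + ((k : ℂ) + 1) = ((k + 1 : ℝ) : ℂ) + ρ * ((x * u : ℝ) : ℂ) := by
  push_cast; ring

lemma corrDenom_ne_zero {x : ℝ} (k : ℕ) (u : ℝ) : ρ * x * u + ((k : ℂ) + 1) ≠ 0 := by
  rw [line_shift_eq]
  exact line_ne_zero (by positivity) _

lemma continuous_corrTerm (x : ℝ) (k : ℕ) : Continuous (corrTerm x k) := by
  unfold corrTerm
  have : Continuous fun u : ℝ => (ρ * x * u + ((k : ℂ) + 1))⁻¹ :=
    Continuous.inv₀ (by fun_prop) (corrDenom_ne_zero k)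
  fun_prop

lemma norm_exp_neg_pi_I_mul_div (x : ℝ) (k : ℕ) :
    ‖Complex.exp (-(Real.pi * I * ((k : ℂ) + 1) ^ 2 / x))‖ = 1 := by
  rw [show -(Real.pi * I * ((k : ℂ) + 1) ^ 2 / x) = ((-(Real.pi * (k + 1) ^ 2 / x) : ℝ) : ℂ) * I by
    push_cast; ring]
  exact Complex.norm_exp_ofReal_mul_I _

lemma norm_corrTerm_le {x : ℝ} (hx : 0 < x) (k : ℕ) (u : ℝ) :
    ‖corrTerm x k u‖ ≤ 2 * √x / (k + 1) ^ 2 * Real.exp (-(Real.pi * x / 2) * u ^ 2) := by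
  have hk : (0 : ℝ) < k + 1 := by positivity
  have hk' : ((k : ℂ) + 1) ≠ 0 := by exact_mod_cast hk.ne'
  have h1 : (k + 1 : ℝ) / 2 ≤ ‖ρ * x * u + ((k : ℂ) + 1)‖ := by
    rw [line_shift_eq]; exact half_le_norm_line _ _
  have h2 : ‖(ρ * x * u + ((k : ℂ) + 1))⁻¹ - ((k : ℂ) + 1)⁻¹‖ ≤ 2 * (x * |u|) / (k + 1) ^ 2 := by
    have e : ‖(k : ℂ) + 1‖ = k + 1 := by
      rw [show (k : ℂ) + 1 = ((k + 1 : ℝ) : ℂ) by push_cast; rfl, Complex.norm_real,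
        Real.norm_of_nonneg hk.le]
    rw [inv_sub_inv (corrDenom_ne_zero k u) hk', norm_div, norm_mul, e,
      show (k : ℂ) + 1 - (ρ * x * u + (k + 1)) = -(ρ * x * u) by ring, norm_neg, norm_mul, norm_mul,
      norm_rho, Complex.norm_real, Complex.norm_real, Real.norm_of_nonneg hx.le, Real.norm_eq_abs,
      one_mul, div_le_div_iff₀ (mul_pos (by linarith) hk) (by positivity)]
    nlinarith [mul_le_mul_of_nonneg_left h1 (by positivity : 0 ≤ 2 * (x * |u|) * (k + 1))]
  have hs : √x * √x = x := Real.mul_self_sqrt hx.le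
  have h3 : √x * |u| ≤ Real.exp (Real.pi * x / 2 * u ^ 2) := by
    have h4 := Real.add_one_le_exp (Real.pi * x / 2 * u ^ 2)
    have h5 : (√x * |u|) ^ 2 = x * u ^ 2 := by rw [mul_pow, sq_abs, sq, hs]
    have h6 : 0 ≤ x * u ^ 2 := by positivity
    nlinarith [Real.pi_gt_three, sq_nonneg (√x * |u| - 1)]
  rw [corrTerm, norm_mul, norm_mul, norm_exp_neg_pi_I_mul_div, one_mul, Complex.norm_real,
    Real.norm_of_nonneg (Real.exp_pos _).le]
  calc _ ≤ Real.exp (-(Real.pi * x * u ^ 2)) * (2 * (x * |u|) / (k + 1) ^ 2) :=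
        mul_le_mul_of_nonneg_left h2 (Real.exp_pos _).le
    _ = 2 * √x / (k + 1) ^ 2 * (√x * |u|) * Real.exp (-(Real.pi * x * u ^ 2)) := by
        rw [← hs, Real.sqrt_mul_self (Real.sqrt_nonneg _)]; ring
    _ ≤ 2 * √x / (k + 1) ^ 2 * Real.exp (Real.pi * x / 2 * u ^ 2) *
          Real.exp (-(Real.pi * x * u ^ 2)) := by gcongr
    _ = _ := by
        rw [mul_assoc, ← Real.exp_add]; congr 2; ring

lemma integral_gaussian_half {x : ℝ} (hx : 0 < x) :
    ∫ u : ℝ, Real.exp (-(Real.pi * x / 2) * u ^ 2) = √2 / √x := by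
  have := Real.pi_pos
  rw [integral_gaussian, ← Real.sqrt_div (by norm_num)]
  congr 1
  field_simp

lemma integrable_corrTerm {x : ℝ} (hx : 0 < x) (k : ℕ) :
    MeasureTheory.Integrable (corrTerm x k) :=
  integrable_of_gaussian_bound (continuous_corrTerm x k) (by positivity) (norm_corrTerm_le hx k)

lemma integral_norm_corrTerm_le {x : ℝ} (hx : 0 < x) (k : ℕ) :
    ∫ u : ℝ, ‖corrTerm x k u‖ ≤ 4 * (1 / (k + 1) ^ 2) := by
  have h1 : ∫ u : ℝ, ‖corrTerm x k u‖ ≤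
      ∫ u : ℝ, 2 * √x / (k + 1) ^ 2 * Real.exp (-(Real.pi * x / 2) * u ^ 2) :=
    MeasureTheory.integral_mono (integrable_corrTerm hx k).norm
      ((integrable_exp_neg_mul_sq (by positivity)).const_mul _) (norm_corrTerm_le hx k)
  refine h1.trans ?_
  rw [MeasureTheory.integral_const_mul, integral_gaussian_half hx]
  have : √x ≠ 0 := (Real.sqrt_pos.2 hx).ne'
  have h2 : √2 ≤ 2 := Real.sqrt_le_iff.2 ⟨by norm_num, by norm_num⟩
  rw [show 2 * √x / ((k : ℝ) + 1) ^ 2 * (√2 / √x) = 2 * √2 * (1 / (k + 1) ^ 2) by field_simp]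
  gcongr
  linarith

lemma summable_inv_succ_sq : Summable fun k : ℕ => 4 * (1 / ((k : ℝ) + 1) ^ 2) := by
  have := (summable_nat_add_iff 1).2 (Real.summable_one_div_nat_pow.2 one_lt_two)
  exact (by simpa using this : Summable fun k : ℕ => 1 / ((k : ℝ) + 1) ^ 2).mul_left 4

lemma hasSum_integral_corrTerm {x : ℝ} (hx : 0 < x) :
    HasSum (fun k => ∫ u : ℝ, corrTerm x k u) (∫ u : ℝ, ∑' k : ℕ, corrTerm x k u) :=
  MeasureTheory.hasSum_integral_of_summable_integral_norm (integrable_corrTerm hx)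
    (Summable.of_nonneg_of_le (fun _ => MeasureTheory.integral_nonneg fun _ => norm_nonneg _)
      (integral_norm_corrTerm_le hx) summable_inv_succ_sq)

lemma norm_sum_integral_corrTerm_le {x : ℝ} (hx : 0 < x) (m : ℕ) :
    ‖∑ k ∈ Finset.range m, ∫ u : ℝ, corrTerm x k u‖ ≤ ∑' k : ℕ, 4 * (1 / ((k : ℝ) + 1) ^ 2) :=
  (norm_sum_le_of_le _ fun k _ => (MeasureTheory.norm_integral_le_integral_norm _).trans
    (integral_norm_corrTerm_le hx k)).trans
    (summable_inv_succ_sq.sum_le_tsum _ fun _ _ => by positivity)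

lemma quadExp_mul_exp (x b : ℝ) (z : ℂ) :
    quadExp x (b - 2) z * Complex.exp (2 * Real.pi * I * z) = quadExp x b z := by
  rw [quadExp, quadExp, ← Complex.exp_add]
  congr 1; push_cast; ring

lemma quadExp_div_oneSubExp (x : ℝ) {z : ℂ} (hz : oneSubExp z ≠ 0) (m : ℕ) :
    quadExp x 0 z / z / oneSubExp z =
      quadExp x (-2 * m) z / z / oneSubExp z
        - ∑ k ∈ Finset.range m, quadExp x (-2 * (k + 1)) z / z := by
  induction m with
  | zero => simp
  | succ m ih =>
    rw [ih, Finset.sum_range_succ, Nat.cast_succ, ← quadExp_mul_exp x (-2 * m),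
      show -2 * (m : ℝ) - 2 = -2 * (m + 1) by ring,
      show Complex.exp (2 * Real.pi * I * z) = 1 - oneSubExp z by rw [oneSubExp]; ring]
    field_simp
    ring

lemma quadExp_saddle {x : ℝ} (hx : 0 < x) (k : ℕ) (u : ℝ) :
    quadExp x (-2 * (k + 1)) ((((k + 1) / x : ℝ) : ℂ) + ρ * u) =
      (Real.exp (-(Real.pi * x * u ^ 2)) : ℝ) *
        Complex.exp (-(Real.pi * I * ((k : ℂ) + 1) ^ 2 / x)) := by
  have hx' : (x : ℂ) ≠ 0 := by exact_mod_cast hx.ne'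
  rw [quadExp, Complex.ofReal_exp, ← Complex.exp_add]
  congr 1
  push_cast
  rw [show Real.pi * I * (x * (((k : ℂ) + 1) / x + ρ * u) ^ 2 +
      -2 * (k + 1) * ((k + 1) / x + ρ * u)) =
      Real.pi * I * (x * ρ ^ 2 * u ^ 2 - (k + 1) ^ 2 / x) by field_simp; ring, rho_sq]
  linear_combination (Real.pi * x * u ^ 2 : ℂ) * Complex.I_sq

lemma integral_quadExp_saddle {x : ℝ} (hx : 0 < x) (k : ℕ) {a : ℝ} (ha : (k + 1) / x ≤ a) :
    ∫ u : ℝ, quadExp x (-2 * (k + 1)) (a + ρ * u) / (a + ρ * u) =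
      x * (∫ u : ℝ, corrTerm x k u) + √x *
        (Complex.exp (-(Real.pi * I * ((k : ℂ) + 1) ^ 2 / x)) / ((k : ℂ) + 1)) := by
  have hx' : (x : ℂ) ≠ 0 := by exact_mod_cast hx.ne'
  have hpos : 0 < (k + 1) / x := by positivity
  obtain ⟨K, -, hK⟩ := exists_norm_quadExp_div_line_le (A := a) hx (-2 * (k + 1)) hpos
  rw [← integral_line_eq_of_gaussian_bound (φ := fun z => quadExp x (-2 * (k + 1)) z / z) ha
    (by positivity) (differentiableOn_quadExp_div x _ hpos) hK]
  have hpt : ∀ u : ℝ, quadExp x (-2 * (k + 1)) ((((k + 1) / x : ℝ) : ℂ) + ρ * u) /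
      ((((k + 1) / x : ℝ) : ℂ) + ρ * u) = x * corrTerm x k u +
      (Real.exp (-(Real.pi * x) * u ^ 2) : ℝ) *
        (x * (Complex.exp (-(Real.pi * I * ((k : ℂ) + 1) ^ 2 / x)) / ((k : ℂ) + 1))) := by
    intro u
    have hd := corrDenom_ne_zero (x := x) k u
    rw [quadExp_saddle hx, corrTerm, neg_mul, show ((((k + 1) / x : ℝ) : ℂ) + ρ * u) =
      (ρ * x * u + ((k : ℂ) + 1)) / x by push_cast; field_simp; ring]
    rw [div_div_eq_mul_div, div_eq_mul_inv, div_eq_mul_inv]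
    ring
  have hg : MeasureTheory.Integrable fun u : ℝ => ((Real.exp (-(Real.pi * x) * u ^ 2) : ℝ) : ℂ) :=
    (integrable_exp_neg_mul_sq (by positivity)).ofReal
  simp only [hpt]
  rw [MeasureTheory.integral_add ((integrable_corrTerm hx k).const_mul _) (hg.mul_const _),
    MeasureTheory.integral_const_mul, MeasureTheory.integral_mul_const, integral_complex_ofReal,
    integral_gaussian]
  have h1 : √(Real.pi / (Real.pi * x)) * x = √x := by
    rw [div_mul_cancel_left₀ Real.pi_ne_zero, Real.sqrt_inv]
    have := (Real.sqrt_pos.2 hx).ne'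
    field_simp
    rw [Real.sq_sqrt hx.le]
  rw [← mul_assoc _ (x : ℂ), ← Complex.ofReal_mul, h1]

/-- The error integral left after extracting `m` saddle points. -/
noncomputable def remainder (x : ℝ) (n m : ℕ) : ℂ :=
  ∫ u : ℝ, quadExp x (-2 * m) (((n + 1 / 2 : ℝ) : ℂ) + ρ * u) / (((n + 1 / 2 : ℝ) : ℂ) + ρ * u) /
    oneSubExp (((n + 1 / 2 : ℝ) : ℂ) + ρ * u)

lemma lineIntegral_eq_remainder {x : ℝ} (hx : 0 < x) {n m : ℕ} (hm : m ≤ n * x) :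
    lineIntegral x (n + 1 / 2) = ρ * remainder x n m - ∑ k ∈ Finset.range m, ρ *
      (x * (∫ u : ℝ, corrTerm x k u) + √x *
        (Complex.exp (-(Real.pi * I * ((k : ℂ) + 1) ^ 2 / x)) / ((k : ℂ) + 1))) := by
  have ha₀ : (0 : ℝ) < n + 1 / 2 := by positivity
  have hmem : (n + 1 / 2 : ℝ) ∈ Set.Icc (n + 1 / 2 : ℝ) (n + 1 / 2) := ⟨le_rfl, le_rfl⟩
  have hc : 0 < Real.pi * x / 2 := by positivity
  have hcont : ∀ b : ℝ, Continuous fun u : ℝ =>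
      quadExp x b (((n + 1 / 2 : ℝ) : ℂ) + ρ * u) / (((n + 1 / 2 : ℝ) : ℂ) + ρ * u) := fun b =>
    continuous_comp_line (φ := fun z => quadExp x b z / z) hmem
      (differentiableOn_quadExp_div x b ha₀).continuousOn
  have hrem : MeasureTheory.Integrable fun u : ℝ =>
      quadExp x (-2 * m) (((n + 1 / 2 : ℝ) : ℂ) + ρ * u) / (((n + 1 / 2 : ℝ) : ℂ) + ρ * u) /
        oneSubExp (((n + 1 / 2 : ℝ) : ℂ) + ρ * u) := by
    obtain ⟨K, -, hK⟩ := exists_norm_quadExp_div_line_le (A := n + 1 / 2) hx (-2 * m) ha₀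
    exact integrable_div_oneSubExp (hcont _) hc (hK _ hmem) n
  have hterm : ∀ k ∈ Finset.range m, MeasureTheory.Integrable fun u : ℝ =>
      quadExp x (-2 * (k + 1)) (((n + 1 / 2 : ℝ) : ℂ) + ρ * u) /
        (((n + 1 / 2 : ℝ) : ℂ) + ρ * u) := by
    intro k _
    obtain ⟨K, -, hK⟩ := exists_norm_quadExp_div_line_le (A := n + 1 / 2) hx (-2 * (k + 1)) ha₀
    exact integrable_of_gaussian_bound (hcont _) hc (hK _ hmem)
  rw [lineIntegral, MeasureTheory.integral_const_mul, remainder, ← Finset.mul_sum, ← mul_sub]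
  simp_rw [quadExp_div_oneSubExp x (oneSubExp_half_integer_ne_zero n _) m]
  rw [MeasureTheory.integral_sub hrem (MeasureTheory.integrable_finsetSum _ hterm),
    MeasureTheory.integral_finsetSum _ hterm]
  congr 2
  refine Finset.sum_congr rfl fun k hk => integral_quadExp_saddle hx k ?_
  have hk' : (k + 1 : ℝ) ≤ m := by exact_mod_cast Finset.mem_range.1 hk
  rw [div_le_iff₀ hx]
  nlinarith

lemma norm_remainder_le {x : ℝ} (hx : 0 < x) (hx1 : x ≤ 1) {n m : ℕ} (hm : m ≤ n * x)
    (hm' : n * x < m + 1) :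
    ‖remainder x n m‖ ≤ 4 * Real.exp 1 * (√2 / √x) / (n + 1 / 2) := by
  set a : ℝ := n + 1 / 2 with ha
  have ha0 : 0 < a := by positivity
  have hpi := Real.pi_pos
  have hpi4 := Real.pi_le_four
  have h2 : √2 * √2 = 2 := Real.mul_self_sqrt (by norm_num)
  have h20 : 0 < √2 := by positivity
  have hb : ∀ u : ℝ, ‖quadExp x (-2 * m) (a + ρ * u) / (a + ρ * u) / oneSubExp (a + ρ * u)‖ ≤
      4 * Real.exp 1 / a * Real.exp (-(Real.pi * x / 2) * u ^ 2) := by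
    intro u
    obtain ⟨d1, d2⟩ := half_le_norm_oneSubExp_half_integer n u
    rw [← ha] at d1 d2
    have hz := half_le_norm_line a u
    have hq : ‖quadExp x (-2 * m) (a + ρ * u)‖ ≤
        2 * (Real.exp 1 * Real.exp (-(Real.pi * x / 2) * u ^ 2)) * ‖oneSubExp (a + ρ * u)‖ := by
      rw [norm_quadExp_line, ← Real.exp_add]
      rcases le_or_gt 0 u with hu | hu
      · calc _ ≤ Real.exp (1 + -(Real.pi * x / 2) * u ^ 2) := by
              refine Real.exp_le_exp.2 ?_
              have h3 : 0 ≤ √2 * Real.pi * u * (x * a - m) :=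
                mul_nonneg (by positivity) (by rw [ha]; nlinarith)
              have h4 : 0 ≤ Real.pi * x * u ^ 2 := by positivity
              nlinarith
          _ = 2 * Real.exp (1 + -(Real.pi * x / 2) * u ^ 2) * (1 / 2) := by ring
          _ ≤ _ := mul_le_mul_of_nonneg_left d1 (by positivity)
      · calc _ ≤ Real.exp (1 + -(Real.pi * x / 2) * u ^ 2 + -(√2 * Real.pi * u)) := by
              refine Real.exp_le_exp.2 ?_
              have h3 : 0 ≤ √2 * Real.pi * (-u) * (x / 2 - (x * a - m - 1)) :=
                mul_nonneg (mul_nonneg (by positivity) (by linarith)) (by rw [ha]; nlinarith)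
              have h4 : 0 ≤ Real.pi * x / 2 * (u + √2 / 2) ^ 2 := by positivity
              have h5 : Real.pi * x ≤ 4 := by nlinarith
              nlinarith
          _ = 2 * Real.exp (1 + -(Real.pi * x / 2) * u ^ 2) *
              (Real.exp (-(√2 * Real.pi * u)) / 2) := by rw [Real.exp_add _ (-(√2 * _ * _))]; ring
          _ ≤ _ := mul_le_mul_of_nonneg_left d2 (by positivity)
    rw [norm_div, norm_div, div_div, div_le_iff₀ (mul_pos (by linarith) (by linarith))]
    refine hq.trans ?_
    have h6 : 1 ≤ 2 / a * ‖(a : ℂ) + ρ * u‖ := by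
      rw [div_mul_eq_mul_div, le_div_iff₀ ha0]; linarith
    calc _ ≤ 2 * (Real.exp 1 * Real.exp (-(Real.pi * x / 2) * u ^ 2)) *
          ‖oneSubExp (a + ρ * u)‖ * (2 / a * ‖(a : ℂ) + ρ * u‖) :=
          le_mul_of_one_le_right (by positivity) h6
      _ = _ := by ring
  refine (MeasureTheory.norm_integral_le_of_norm_le
    ((integrable_exp_neg_mul_sq (by positivity)).const_mul _) (Eventually.of_forall hb)).trans ?_
  rw [MeasureTheory.integral_const_mul, integral_gaussian_half hx]
  exact le_of_eq (by ring)

lemma norm_quadExp_natCast (x : ℝ) (n : ℕ) : ‖quadExp x 0 (n : ℂ)‖ = 1 := by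
  rw [quadExp, show (Real.pi : ℂ) * I * (x * (n : ℂ) ^ 2 + ((0 : ℝ) : ℂ) * n) =
    ((Real.pi * x * n ^ 2 : ℝ) : ℂ) * I by push_cast; ring]
  exact Complex.norm_exp_ofReal_mul_I _

lemma norm_Fpart_one_le (n : ℕ) (x : ℝ) : ‖Fpart 1 n x 0‖ ≤ 1 + Real.log n := by
  refine le_trans ?_ (harmonic_le_one_add_log n)
  rw [Fpart_one_eq_sum, harmonic, Rat.cast_sum]
  refine norm_sum_le_of_le _ fun k _ => ?_
  rw [norm_div, norm_quadExp_natCast, Complex.norm_natCast]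
  push_cast
  exact le_of_eq (one_div _)

lemma Fpart_one_neg (n : ℕ) (x : ℝ) :
    Fpart 1 n (-x) 0 = (starRingEnd ℂ) (Fpart 1 n x 0) := by
  rw [Fpart_one_eq_sum, Fpart_one_eq_sum, map_sum]
  refine Finset.sum_congr rfl fun k _ => ?_
  rw [map_div₀, quadExp, quadExp, ← Complex.exp_conj, Complex.conj_natCast]
  congr 2
  simp

lemma Fpart_one_Tmap (n : ℕ) (x : ℝ) : Fpart 1 n (Tmap x) 0 = Fpart 1 n (-1 / x) 0 := by
  rw [Fpart_one_eq_sum, Fpart_one_eq_sum]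
  refine Finset.sum_congr rfl fun k _ => ?_
  congr 1
  rw [Tmap]
  generalize ⌈(-1 / x - 1) / 2⌉ = c
  generalize -1 / x = y
  have h : quadExp y 0 ((k + 1 : ℕ) : ℂ) = quadExp (y - 2 * c) 0 ((k + 1 : ℕ) : ℂ) *
      Complex.exp (((c * (k + 1) ^ 2 : ℤ) : ℂ) * (2 * Real.pi * I)) := by
    rw [quadExp, quadExp, ← Complex.exp_add]
    congr 1; push_cast; ring
  rw [h, Complex.exp_int_mul_two_pi_mul_I, mul_one]

lemma Fpart_one_neg_inv (m : ℕ) (x : ℝ) : Fpart 1 m (-1 / x) 0 =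
    ∑ k ∈ Finset.range m,
      Complex.exp (-(Real.pi * I * ((k : ℂ) + 1) ^ 2 / x)) / ((k : ℂ) + 1) := by
  rw [Fpart_one_eq_sum]
  refine Finset.sum_congr rfl fun k _ => ?_
  rw [quadExp]
  push_cast
  congr 2; ring

/-- The defect in the approximate functional equation relating `x > 0` and `-1/x`. -/
noncomputable def posDefect (n : ℕ) (x : ℝ) : ℂ :=
  Fpart 1 n x 0 - ρ * √x * Fpart 1 ⌊n * x⌋₊ (-1 / x) 0

lemma posDefect_eq {x : ℝ} (hx : 0 < x) (n : ℕ) : posDefect n x =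
    lineIntegral x (1 / 2) + ρ * x * (∑ k ∈ Finset.range ⌊n * x⌋₊, ∫ u : ℝ, corrTerm x k u)
      - ρ * remainder x n ⌊n * x⌋₊ := by
  rw [posDefect, Fpart_one_eq_lineIntegral hx,
    lineIntegral_eq_remainder hx (Nat.floor_le (by positivity)), ← Finset.mul_sum,
    Finset.sum_add_distrib, ← Finset.mul_sum, ← Finset.mul_sum, Fpart_one_neg_inv]
  ring

lemma norm_remainder_floor_le {x : ℝ} (hx : 0 < x) (hx1 : x ≤ 1) (n : ℕ) :
    ‖remainder x n ⌊n * x⌋₊‖ ≤ 4 * Real.exp 1 * (√2 / √x) / (n + 1 / 2) :=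
  norm_remainder_le hx hx1 (Nat.floor_le (by positivity)) (Nat.lt_floor_add_one _)

lemma tendsto_posDefect {x : ℝ} (hx : 0 < x) (hx1 : x ≤ 1) :
    Tendsto (fun n => posDefect n x) atTop (𝓝 (Ifun 1 x 0)) := by
  rw [Ifun_one_zero]
  simp_rw [posDefect_eq hx]
  have hfloor : Tendsto (fun n : ℕ => ⌊(n : ℝ) * x⌋₊) atTop atTop :=
    tendsto_nat_floor_atTop.comp (tendsto_natCast_atTop_atTop.atTop_mul_const hx)
  have h1 := ((hasSum_integral_corrTerm hx).tendsto_sum_nat.comp hfloor).const_mul (ρ * x)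
  have h2 : Tendsto (fun n : ℕ => remainder x n ⌊n * x⌋₊) atTop (𝓝 0) := by
    refine squeeze_zero_norm (norm_remainder_floor_le hx hx1) ?_
    exact Tendsto.const_div_atTop
      (tendsto_atTop_add_const_right _ _ tendsto_natCast_atTop_atTop) _
  simpa using (h1.const_add (lineIntegral x (1 / 2))).sub (h2.const_mul ρ)

lemma norm_posDefect_le_log {x : ℝ} (hx1 : x ≤ 1) (n : ℕ) :
    ‖posDefect n x‖ ≤ 2 * (1 + Real.log n) := by
  have hfl : ⌊n * x⌋₊ ≤ n := Nat.floor_le_of_le (mul_le_of_le_one_right n.cast_nonneg hx1)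
  have hlog : Real.log (⌊n * x⌋₊ : ℕ) ≤ Real.log n := by
    rcases Nat.eq_zero_or_pos ⌊n * x⌋₊ with h | h
    · rw [h]; simpa using Real.log_natCast_nonneg n
    · exact Real.log_le_log (by exact_mod_cast h) (by exact_mod_cast hfl)
  have h1 : ‖ρ * (√x : ℂ)‖ ≤ 1 := by
    rw [norm_mul, norm_rho, one_mul, Complex.norm_real, Real.norm_of_nonneg (Real.sqrt_nonneg _)]
    exact Real.sqrt_le_one.2 hx1
  have h2 := norm_Fpart_one_le n x
  have h3 := (norm_Fpart_one_le ⌊n * x⌋₊ (-1 / x)).trans (add_le_add_right hlog 1)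
  calc _ ≤ ‖Fpart 1 n x 0‖ + ‖ρ * √x * Fpart 1 ⌊n * x⌋₊ (-1 / x) 0‖ := norm_sub_le _ _
    _ ≤ (1 + Real.log n) + 1 * (1 + Real.log n) := by
        rw [norm_mul]
        exact add_le_add h2 (mul_le_mul h1 h3 (norm_nonneg _) zero_le_one)
    _ = _ := by ring

lemma exists_norm_posDefect_le : ∃ C : ℝ, 0 ≤ C ∧ ∀ x : ℝ, 0 < x → x ≤ 1 → ∀ n : ℕ,
    ‖posDefect n x‖ ≤ C * (1 + Real.log (1 / x)) := by
  set S : ℝ := ∑' k : ℕ, 4 * (1 / ((k : ℝ) + 1) ^ 2) with hS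
  have hS0 : 0 ≤ S := tsum_nonneg fun _ => by positivity
  refine ⟨4 + 2 * S + 2 * (4 * Real.exp 1 * √2), by positivity, fun x hx hx1 n => ?_⟩
  have hsx : 0 < √x := Real.sqrt_pos.2 hx
  have hsx1 : √x ≤ 1 := Real.sqrt_le_one.2 hx1
  have hL : 0 ≤ Real.log (1 / x) := Real.log_nonneg (by rw [le_div_iff₀ hx]; linarith)
  have hLs : Real.log (1 / √x) = Real.log (1 / x) / 2 := by
    rw [one_div, Real.log_inv, Real.log_sqrt hx.le, one_div, Real.log_inv]; ring
  have he : 0 ≤ 4 * Real.exp 1 * √2 := by positivity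
  have hE : ∀ m : ℕ, 1 / √x ≤ m →
      ‖posDefect m x - lineIntegral x (1 / 2)‖ ≤ S + 4 * Real.exp 1 * √2 := by
    intro m hm
    rw [posDefect_eq hx, add_sub_assoc, add_sub_cancel_left]
    refine (norm_sub_le _ _).trans (add_le_add ?_ ?_)
    · rw [norm_mul, norm_mul, norm_rho, one_mul, Complex.norm_real, Real.norm_of_nonneg hx.le]
      exact (mul_le_of_le_one_left (norm_nonneg _) hx1).trans (norm_sum_integral_corrTerm_le hx _)
    · rw [norm_mul, norm_rho, one_mul]
      refine (norm_remainder_floor_le hx hx1 m).trans ?_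
      rw [div_le_iff₀ hsx] at hm
      rw [← mul_div_assoc, div_div]
      exact div_le_self he (by nlinarith)
  rcases lt_or_ge (n : ℝ) (1 / √x) with hn | hn
  · refine (norm_posDefect_le_log hx1 n).trans ?_
    have hlog : Real.log n ≤ Real.log (1 / x) := by
      rcases Nat.eq_zero_or_pos n with h | h
      · rw [h]; simpa using hL
      · have := Real.log_le_log (by exact_mod_cast h) hn.le
        linarith
    nlinarith
  · set n₀ := ⌈1 / √x⌉₊ with hn₀
    have h1 := hE n hn
    have h2 := hE n₀ (Nat.le_ceil _)
    have h3 := norm_posDefect_le_log hx1 n₀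
    have hpos : 0 < 1 / √x := by positivity
    have h4 : Real.log n₀ ≤ 1 + Real.log (1 / x) := by
      have h5 : (n₀ : ℝ) ≤ 2 * (1 / √x) := by
        have h6 := (Nat.ceil_lt_add_one hpos.le).le
        have h7 : 1 ≤ 1 / √x := by rw [le_div_iff₀ hsx]; linarith
        linarith
      have h8 := Real.log_le_log (by exact_mod_cast Nat.ceil_pos.2 hpos) h5
      rw [Real.log_mul two_ne_zero hpos.ne', hLs] at h8
      linarith [Real.log_two_lt_d9]
    have h9 : ‖posDefect n x‖ ≤ ‖posDefect n x - lineIntegral x (1 / 2)‖ +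
        ‖posDefect n₀ x - lineIntegral x (1 / 2)‖ + ‖posDefect n₀ x‖ := by
      have := norm_add₃_le (a := posDefect n x - lineIntegral x (1 / 2))
        (b := -(posDefect n₀ x - lineIntegral x (1 / 2))) (c := posDefect n₀ x)
      rw [norm_neg] at this
      refine le_trans (le_of_eq ?_) this
      congr 1; ring
    nlinarith [mul_nonneg hS0 hL, mul_nonneg he hL]

/-- The multiplier `e^{iπσ(x)/4} √|x|` of the functional equation. -/
noncomputable def multiplier (x : ℝ) : ℂ :=
  Complex.exp (Real.pi * I / 4 * (Real.sign x : ℂ)) * √|x|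

/-- The defect in the approximate functional equation relating `x` and `Tmap x`. -/
noncomputable def defect (n : ℕ) (x : ℝ) : ℂ :=
  Fpart 1 n x 0 - multiplier x * Fpart 1 ⌊n * |x|⌋₊ (Tmap x) 0

lemma defect_of_pos {x : ℝ} (hx : 0 < x) (n : ℕ) : defect n x = posDefect n x := by
  rw [defect, posDefect, multiplier, Real.sign_of_pos hx, abs_of_pos hx, Complex.ofReal_one,
    mul_one, Fpart_one_Tmap, ρ]

lemma defect_of_neg {x : ℝ} (hx : x < 0) (n : ℕ) :
    defect n x = (starRingEnd ℂ) (posDefect n (-x)) := by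
  rw [defect, posDefect, multiplier, Real.sign_of_neg hx, abs_of_neg hx, Fpart_one_Tmap, map_sub,
    map_mul, map_mul, ← Fpart_one_neg, ← Fpart_one_neg, neg_neg, Complex.conj_ofReal, ρ,
    ← Complex.exp_conj, show -(-1 / -x) = -1 / x by rw [div_neg, neg_neg]]
  congr 4
  simp [Complex.conj_ofNat]
  ring

lemma tendsto_defect {x : ℝ} (hx0 : x ≠ 0) (hx1 : |x| ≤ 1) :
    Tendsto (fun n => defect n x) atTop (𝓝 (Omega0 1 x)) := by
  rw [Omega0, Omega]
  rcases hx0.lt_or_gt with h | h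
  · rw [if_neg h.not_gt, neg_zero]
    simp_rw [defect_of_neg h]
    rw [abs_of_neg h] at hx1
    exact (Complex.continuous_conj.tendsto _).comp (tendsto_posDefect (neg_pos.2 h) hx1)
  · rw [if_pos h]
    simp_rw [defect_of_pos h]
    rw [abs_of_pos h] at hx1
    exact tendsto_posDefect h hx1

lemma exists_norm_defect_le : ∃ C : ℝ, 0 ≤ C ∧ ∀ x : ℝ, x ≠ 0 → |x| ≤ 1 → ∀ n : ℕ,
    ‖defect n x‖ ≤ C * (1 + Real.log (1 / |x|)) := by
  obtain ⟨C, hC0, hC⟩ := exists_norm_posDefect_le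
  refine ⟨C, hC0, fun x hx0 hx1 n => ?_⟩
  rcases hx0.lt_or_gt with h | h
  · rw [defect_of_neg h, Complex.norm_conj]
    rw [abs_of_neg h] at hx1 ⊢
    exact hC _ (neg_pos.2 h) hx1 n
  · rw [defect_of_pos h]
    rw [abs_of_pos h] at hx1 ⊢
    exact hC _ h hx1 n

lemma Tmap_mem_Ioo {x : ℝ} (hirr : Irrational x) :
    Tmap x ∈ Set.Ioo (-1 : ℝ) 1 ∧ Irrational (Tmap x) := by
  have hT : Irrational (Tmap x) := by
    have h1 : Irrational (-1 / x) := by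
      rw [neg_div, one_div]; exact hirr.inv.neg
    have := h1.sub_intCast (2 * ⌈(-1 / x - 1) / 2⌉)
    rwa [Int.cast_mul, Int.cast_ofNat] at this
  refine ⟨⟨?_, lt_of_le_of_ne ?_ (by simpa using hT.ne_one)⟩, hT⟩
  · have := Int.ceil_lt_add_one ((-1 / x - 1) / 2)
    rw [Tmap]; linarith
  · have := Int.le_ceil ((-1 / x - 1) / 2)
    rw [Tmap]; linarith

lemma Tmap_iterate_mem_Ioo {x : ℝ} (hx : x ∈ Set.Ioo (-1 : ℝ) 1) (hirr : Irrational x) (j : ℕ) :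
    Tmap^[j] x ∈ Set.Ioo (-1 : ℝ) 1 ∧ Irrational (Tmap^[j] x) := by
  induction j with
  | zero => exact ⟨hx, hirr⟩
  | succ j ih =>
    rw [Function.iterate_succ_apply']
    exact Tmap_mem_Ioo ih.2

/-- The lengths of the partial sums obtained by iterating the approximate functional equation. -/
noncomputable def iterLength (x : ℝ) (n : ℕ) : ℕ → ℕ
  | 0 => n
  | j + 1 => ⌊iterLength x n j * |Tmap^[j] x|⌋₊

lemma Fpart_one_eq_sum_defect (x : ℝ) (n J : ℕ) : Fpart 1 n x 0 =
    ∑ j ∈ Finset.range J, (∏ ℓ ∈ Finset.range j, multiplier (Tmap^[ℓ] x)) *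
        defect (iterLength x n j) (Tmap^[j] x)
      + (∏ ℓ ∈ Finset.range J, multiplier (Tmap^[ℓ] x)) *
        Fpart 1 (iterLength x n J) (Tmap^[J] x) 0 := by
  induction J with
  | zero => simp [iterLength]
  | succ J ih =>
    rw [ih, Finset.sum_range_succ, Finset.prod_range_succ, iterLength,
      Function.iterate_succ_apply', defect]
    ring

lemma iterLength_le {x : ℝ} (h : ∀ j, |Tmap^[j] x| < 1) (n j : ℕ) : iterLength x n j ≤ n - j := by
  induction j with
  | zero => exact le_rfl
  | succ j ih =>
    have h1 : iterLength x n (j + 1) ≤ iterLength x n j - 1 := by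
      rw [iterLength]
      rcases Nat.eq_zero_or_pos (iterLength x n j) with h0 | h0
      · simp [h0]
      · refine Nat.le_sub_one_of_lt ((Nat.floor_lt (by positivity)).2 ?_)
        exact mul_lt_of_lt_one_right (by exact_mod_cast h0) (h j)
    omega

lemma tendsto_iterLength {x : ℝ} (h : ∀ j, Tmap^[j] x ≠ 0) (j : ℕ) :
    Tendsto (fun n => iterLength x n j) atTop atTop := by
  induction j with
  | zero => exact tendsto_id
  | succ j ih =>
    exact tendsto_nat_floor_atTop.comp
      ((tendsto_natCast_atTop_atTop.comp ih).atTop_mul_const (abs_pos.2 (h j)))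

lemma prod_multiplier (x : ℝ) (j : ℕ) : ∏ ℓ ∈ Finset.range j, multiplier (Tmap^[ℓ] x) =
    Complex.exp (Real.pi * I / 4 * ((∑ ℓ ∈ Finset.range j, Real.sign (Tmap^[ℓ] x) : ℝ) : ℂ))
      * ((√(∏ ℓ ∈ Finset.range j, |Tmap^[ℓ] x|) : ℝ) : ℂ) := by
  induction j with
  | zero => simp
  | succ j ih =>
    rw [Finset.prod_range_succ, ih, Finset.sum_range_succ, Finset.prod_range_succ,
      Real.sqrt_mul (Finset.prod_nonneg fun _ _ => abs_nonneg _), multiplier, Complex.ofReal_add,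
      mul_add, Complex.exp_add, Complex.ofReal_mul]
    ring

lemma norm_prod_multiplier (x : ℝ) (j : ℕ) :
    ‖∏ ℓ ∈ Finset.range j, multiplier (Tmap^[ℓ] x)‖ = √(∏ ℓ ∈ Finset.range j, |Tmap^[ℓ] x|) := by
  rw [prod_multiplier, norm_mul, Complex.norm_real, Real.norm_of_nonneg (Real.sqrt_nonneg _),
    show Real.pi * I / 4 * ((∑ ℓ ∈ Finset.range j, Real.sign (Tmap^[ℓ] x) : ℝ) : ℂ) =
      ((Real.pi / 4 * ∑ ℓ ∈ Finset.range j, Real.sign (Tmap^[ℓ] x) : ℝ) : ℂ) * I by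
      push_cast; ring, Complex.norm_exp_ofReal_mul_I, one_mul]

/-- convergence of `F_1(x)` and the `T`-expansion. -/
theorem stmt11 (x : ℝ) (hx : x ∈ Set.Ioo (-1 : ℝ) 1) (hirr : Irrational x)
    (hsum1 : Summable (fun j : ℕ => Real.sqrt (∏ ℓ ∈ Finset.range j, |Tmap^[ℓ] x|)))
    (hsum2 : Summable (fun j : ℕ =>
      Real.sqrt (∏ ℓ ∈ Finset.range j, |Tmap^[ℓ] x|) * Real.log (1 / |Tmap^[j] x|))) :
    ∃ L : ℂ, Tendsto (fun n : ℕ => Fpart 1 n x 0) atTop (𝓝 L) ∧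
      HasSum (fun j : ℕ =>
        Complex.exp (Real.pi * Complex.I / 4
            * ((∑ ℓ ∈ Finset.range j, Real.sign (Tmap^[ℓ] x) : ℝ) : ℂ))
          * ((Real.sqrt (∏ ℓ ∈ Finset.range j, |Tmap^[ℓ] x|) : ℝ) : ℂ)
          * Omega0 1 (Tmap^[j] x)) L ∧
      Summable (fun j : ℕ =>
        ‖Complex.exp (Real.pi * Complex.I / 4
            * ((∑ ℓ ∈ Finset.range j, Real.sign (Tmap^[ℓ] x) : ℝ) : ℂ))
          * ((Real.sqrt (∏ ℓ ∈ Finset.range j, |Tmap^[ℓ] x|) : ℝ) : ℂ)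
          * Omega0 1 (Tmap^[j] x)‖) := by
  have hT := Tmap_iterate_mem_Ioo hx hirr
  have h0 : ∀ j, Tmap^[j] x ≠ 0 := fun j => (hT j).2.ne_zero
  have h1 : ∀ j, |Tmap^[j] x| < 1 := fun j => abs_lt.2 (hT j).1
  obtain ⟨C, -, hC⟩ := exists_norm_defect_le
  set W : ℕ → ℂ := fun j => ∏ ℓ ∈ Finset.range j, multiplier (Tmap^[ℓ] x) with hW
  set B : ℕ → ℝ := fun j => √(∏ ℓ ∈ Finset.range j, |Tmap^[ℓ] x|) *
    (C * (1 + Real.log (1 / |Tmap^[j] x|))) with hB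
  have hBsum : Summable B := by
    refine ((hsum1.add hsum2).mul_left C).congr fun j => ?_
    simp only [hB]; ring
  have hlim : ∀ j, Tendsto (fun n => W j * defect (iterLength x n j) (Tmap^[j] x)) atTop
      (𝓝 (W j * Omega0 1 (Tmap^[j] x))) := fun j =>
    ((tendsto_defect (h0 j) (h1 j).le).comp (tendsto_iterLength h0 j)).const_mul _
  have hbound : ∀ n j, ‖W j * defect (iterLength x n j) (Tmap^[j] x)‖ ≤ B j := by
    intro n j
    rw [norm_mul, hW, norm_prod_multiplier]
    exact mul_le_mul_of_nonneg_left (hC _ (h0 j) (h1 j).le _) (Real.sqrt_nonneg _)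
  have hbound' : ∀ j, ‖W j * Omega0 1 (Tmap^[j] x)‖ ≤ B j := fun j =>
    le_of_tendsto (hlim j).norm (Eventually.of_forall fun n => hbound n j)
  have hnorm : Summable fun j => ‖W j * Omega0 1 (Tmap^[j] x)‖ :=
    Summable.of_nonneg_of_le (fun _ => norm_nonneg _) hbound' hBsum
  have hF : ∀ n, Fpart 1 n x 0 = ∑' j, W j * defect (iterLength x n j) (Tmap^[j] x) := by
    intro n
    have hz : ∀ j, n ≤ j → iterLength x n j = 0 := fun j hj => by
      have := iterLength_le h1 n j
      omega
    rw [tsum_eq_sum (s := Finset.range n), Fpart_one_eq_sum_defect x n n, hz n le_rfl]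
    · simp [Fpart, hW]
    · intro j hj
      rw [hz j (by simpa using hj)]
      simp [defect, Fpart]
  simp only [← prod_multiplier]
  refine ⟨∑' j, W j * Omega0 1 (Tmap^[j] x), ?_, hnorm.of_norm.hasSum, hnorm⟩
  simp_rw [hF]
  exact tendsto_tsum_of_dominated_convergence hBsum hlim
    (Eventually.of_forall fun n j => hbound n j)
end

section
/- Let α > 0 and 0 ≤ β < β_α, where β_α = (√(α² + 4) − 1)/2, and let x ∈ (0,1) be irrational with regular continued fraction convergent denominators (Q_n)_{n≥0}. If Σ_{n=1}^{∞} Q_{n+1}^{β+1} / Q_n^{α+β+1} < ∞, then the series Σ_{j=0}^{∞} (Π_{ℓ=0}^{j−1} |T^ℓ(x)|)^{α} / |T^j(x)|^{β} converges (empty product equal to 1 for j = 0). -/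
open Complex Filter Finset

/-- Only the residue of `|z|⁻¹` modulo `2` matters for `|Tmap z|`. -/
theorem abs_Tmap_eq {z s : ℝ} {N : ℤ} (h : |z|⁻¹ = s + 2 * N) (hs : |s| < 1) :
    |Tmap z| = |s| := by
  have key : ∀ (t : ℝ) (M : ℤ), -1 / z = t + 2 * M → |t| < 1 → Tmap z = t := by
    intro t M ht h1
    have h1 := abs_lt.1 h1
    have hc : ⌈((-1 / z) - 1) / 2⌉ = M := by
      rw [Int.ceil_eq_iff, ht]
      constructor <;> linarith
    rw [Tmap, hc, ht]
    ring
  rcases le_total 0 z with hz | hz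
  · rw [abs_of_nonneg hz] at h
    rw [key (-s) (-N) (by rw [neg_div, one_div, h]; push_cast; ring) (by rwa [abs_neg]), abs_neg]
  · rw [abs_of_nonpos hz] at h
    rw [key s N (by rw [← h, inv_neg, neg_div, one_div]) hs]

theorem abs_Tmap_eq_or {z f : ℝ} {m : ℕ} (h : |z|⁻¹ = m + f) (h0 : 0 < f) (h1 : f < 1) :
    |Tmap z| = f ∨ |Tmap z| = 1 - f := by
  rcases Nat.even_or_odd' m with ⟨c, rfl | rfl⟩
  · left
    rw [abs_Tmap_eq (s := f) (N := c) (by rw [h]; push_cast; ring)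
      (by rw [abs_of_pos h0]; exact h1), abs_of_pos h0]
  · right
    rw [abs_Tmap_eq (s := f - 1) (N := c + 1) (by rw [h]; push_cast; ring)
      (by rw [abs_of_neg (by linarith)]; linarith), abs_of_neg (by linarith)]
    ring

section Orbit

variable {α β x : ℝ} {y : ℕ → ℝ} {a : ℕ → ℕ}

/-- The contribution of the `n`-th regular continued fraction digit to the sum along the orbit. -/
noncomputable def digitBound (α β : ℝ) (y : ℕ → ℝ) (a : ℕ → ℕ) (n : ℕ) : ℝ :=
  2 ^ β * a n * (∏ i ∈ Finset.range n, y i) ^ α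
    + 2 ^ (α + β) * ((∏ i ∈ Finset.range n, y i) ^ α / y n ^ β)

theorem digitBound_nonneg (hy0 : ∀ n, 0 < y n) (n : ℕ) : 0 ≤ digitBound α β y a n := by
  have h1 : 0 < ∏ i ∈ Finset.range n, y i := Finset.prod_pos fun i _ => hy0 i
  have h2 := hy0 n
  unfold digitBound
  positivity

/-- The `j`-th point of the `Tmap`-orbit is, in absolute value, either a point `y n` of the Gauss
orbit or one of the intermediate points `(k - 1 + y (n + 1)) / (k + y (n + 1))`, `1 ≤ k ≤ a n`, with
the corresponding value of the product and bound on the partial sum. -/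
def OrbitState (α β x : ℝ) (y : ℕ → ℝ) (a : ℕ → ℕ) (j : ℕ) : Prop :=
  ∃ n,
    (|Tmap^[j] x| = y n ∧
      ∏ l ∈ Finset.range j, |Tmap^[l] x| = ∏ i ∈ Finset.range n, y i ∧
      ∑ m ∈ Finset.range j, (∏ l ∈ Finset.range m, |Tmap^[l] x|) ^ α / |Tmap^[m] x| ^ β
        ≤ ∑ m ∈ Finset.range n, digitBound α β y a m) ∨
    ∃ k : ℕ, 1 ≤ k ∧ k ≤ a n ∧
      |Tmap^[j] x| = (k - 1 + y (n + 1)) / (k + y (n + 1)) ∧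
      ∏ l ∈ Finset.range j, |Tmap^[l] x|
        = (∏ i ∈ Finset.range (n + 1), y i) * (k + y (n + 1)) ∧
      ∑ m ∈ Finset.range j, (∏ l ∈ Finset.range m, |Tmap^[l] x|) ^ α / |Tmap^[m] x| ^ β
        ≤ ∑ m ∈ Finset.range n, digitBound α β y a m
          + (a n - k) * (2 ^ β * (∏ i ∈ Finset.range n, y i) ^ α)

theorem orbit_state (hα : 0 ≤ α) (hβ : 0 ≤ β) (hy0 : ∀ n, 0 < y n) (hy1 : ∀ n, y n < 1)
    (ha : ∀ n, 1 ≤ a n) (hya : ∀ n, (y n)⁻¹ = a n + y (n + 1)) (hx : y 0 = |x|) (j : ℕ) :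
    OrbitState α β x y a j := by
  have hRpos : ∀ n, 0 < ∏ i ∈ Finset.range n, y i := fun n => Finset.prod_pos fun i _ => hy0 i
  have hmul : ∀ n, y n * (a n + y (n + 1)) = 1 := fun n => by
    rw [← hya, mul_inv_cancel₀ (hy0 n).ne']
  have entry : ∀ j n, (|Tmap^[j] x| = y n ∨ |Tmap^[j] x| = 1 - y n) →
      ∏ l ∈ Finset.range j, |Tmap^[l] x| = ∏ i ∈ Finset.range n, y i →
      ∑ m ∈ Finset.range j, (∏ l ∈ Finset.range m, |Tmap^[l] x|) ^ α / |Tmap^[m] x| ^ β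
          ≤ ∑ m ∈ Finset.range n, digitBound α β y a m → OrbitState α β x y a j := by
    intro j n h hP hS
    rcases h with h | h
    · exact ⟨n, Or.inl ⟨h, hP, hS⟩⟩
    · refine ⟨n, Or.inr ⟨a n, ha n, le_rfl, ?_, ?_, ?_⟩⟩
      · have h1 : (0 : ℝ) < a n + y (n + 1) := by have := hy0 (n + 1); positivity
        rw [h, eq_div_iff h1.ne']
        linear_combination -(hmul n)
      · rw [hP, Finset.prod_range_succ, mul_assoc, hmul, mul_one]
      · simpa using hS
  induction j with
  | zero => exact entry 0 0 (Or.inl (by simp [hx])) (by simp) (by simp)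
  | succ j ih =>
    obtain ⟨n, ⟨hz, hP, hS⟩ | ⟨k, hk1, hka, hz, hP, hS⟩⟩ := ih
    · refine entry (j + 1) (n + 1) ?_ ?_ ?_
      · rw [Function.iterate_succ_apply']
        exact abs_Tmap_eq_or (m := a n) (by rw [hz, hya]) (hy0 _) (hy1 _)
      · rw [Finset.prod_range_succ, Finset.prod_range_succ, hz, hP]
      · rw [Finset.sum_range_succ, Finset.sum_range_succ, hz, hP]
        refine add_le_add hS ?_
        have h1 := hRpos n
        have h2 := hy0 n
        have h3 : (1 : ℝ) ≤ 2 ^ (α + β) := Real.one_le_rpow one_le_two (by positivity)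
        have h4 : 0 ≤ (∏ i ∈ Finset.range n, y i) ^ α / y n ^ β := by positivity
        have h5 : 0 ≤ 2 ^ β * a n * (∏ i ∈ Finset.range n, y i) ^ α := by positivity
        unfold digitBound
        nlinarith
    · have hy' := hy0 (n + 1)
      have hy1' := hy1 (n + 1)
      have hR := hRpos (n + 1)
      rcases hk1.eq_or_lt with rfl | hk2
      · simp only [Nat.cast_one, sub_self, zero_add] at hz hP hS
        refine entry (j + 1) (n + 2) ?_ ?_ ?_
        · rw [Function.iterate_succ_apply']
          refine abs_Tmap_eq_or (m := a (n + 1) + 1) ?_ (hy0 _) (hy1 _)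
          rw [hz, inv_div, add_div, div_self hy'.ne', one_div, hya]
          push_cast
          ring
        · rw [Finset.prod_range_succ, Finset.prod_range_succ _ (n + 1), hz, hP]
          field_simp
        · rw [Finset.sum_range_succ, Finset.sum_range_succ _ (n + 1), Finset.sum_range_succ _ n]
          have hterm : (∏ l ∈ Finset.range j, |Tmap^[l] x|) ^ α / |Tmap^[j] x| ^ β
              ≤ 2 ^ (α + β) * ((∏ i ∈ Finset.range (n + 1), y i) ^ α / y (n + 1) ^ β) := by
            rw [hz, hP]
            set R := ∏ i ∈ Finset.range (n + 1), y i
            set w := y (n + 1)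
            calc (R * (1 + w)) ^ α / (w / (1 + w)) ^ β
                ≤ (R * 2) ^ α / (w / 2) ^ β := by gcongr <;> linarith
              _ = 2 ^ (α + β) * (R ^ α / w ^ β) := by
                rw [Real.mul_rpow hR.le zero_le_two, Real.div_rpow hy'.le zero_le_two,
                  Real.rpow_add two_pos]
                field_simp
          have h1 := hRpos n
          have h2 := hy0 n
          have h3 : 0 ≤ 2 ^ (α + β) * ((∏ i ∈ Finset.range n, y i) ^ α / y n ^ β) := by positivity
          have h4 : 0 ≤ 2 ^ β * a (n + 1) * (∏ i ∈ Finset.range (n + 1), y i) ^ α := by positivity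
          have h5 : 0 ≤ 2 ^ β * (∏ i ∈ Finset.range n, y i) ^ α := by positivity
          unfold digitBound at hS ⊢
          linarith
      · obtain ⟨k, rfl⟩ : ∃ i, k = i + 1 := ⟨k - 1, by omega⟩
        have hk : (1 : ℝ) ≤ k := by exact_mod_cast Nat.lt_succ_iff.1 hk2
        have hka' : (k : ℝ) + 1 ≤ a n := by exact_mod_cast hka
        push_cast at hz hP hS
        have hd : (0 : ℝ) < k + y (n + 1) := by positivity
        have hd' : (0 : ℝ) < k + 1 + y (n + 1) := by positivity
        rw [add_sub_cancel_right] at hz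
        refine ⟨n, Or.inr ⟨k, by omega, by omega, ?_, ?_, ?_⟩⟩
        · have hs : (k + y (n + 1))⁻¹ - 1 = -((k - 1 + y (n + 1)) / (k + y (n + 1))) := by
            field_simp
            ring
          have hpos : 0 ≤ (k - 1 + y (n + 1)) / (k + y (n + 1)) :=
            div_nonneg (by linarith) hd.le
          rw [Function.iterate_succ_apply',
            abs_Tmap_eq (s := (k + y (n + 1))⁻¹ - 1) (N := 1), hs, abs_neg, abs_of_nonneg hpos]
          · rw [hz, inv_div]
            push_cast
            field_simp
            ring
          · rw [hs, abs_neg, abs_of_nonneg hpos, div_lt_one hd]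
            linarith
        · rw [Finset.prod_range_succ, hz, hP]
          field_simp
        · rw [Finset.sum_range_succ]
          have hterm : (∏ l ∈ Finset.range j, |Tmap^[l] x|) ^ α / |Tmap^[j] x| ^ β
              ≤ 2 ^ β * (∏ i ∈ Finset.range n, y i) ^ α := by
            rw [hz, hP]
            have h1 : (∏ i ∈ Finset.range (n + 1), y i) * (k + 1 + y (n + 1))
                ≤ ∏ i ∈ Finset.range n, y i := by
              rw [Finset.prod_range_succ, mul_assoc]
              refine mul_le_of_le_one_right (hRpos n).le ?_
              exact (mul_le_mul_of_nonneg_left (by linarith) (hy0 n).le).trans_eq (hmul n)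
            have h3 := hRpos n
            have h2 : (2 : ℝ)⁻¹ ≤ (k + y (n + 1)) / (k + 1 + y (n + 1)) := by
              rw [le_div_iff₀ hd']
              linarith
            calc _ ≤ (∏ i ∈ Finset.range n, y i) ^ α / ((2 : ℝ)⁻¹) ^ β := by gcongr
              _ = _ := by rw [Real.inv_rpow zero_le_two, div_inv_eq_mul, mul_comm]
          linarith

theorem summable_orbit (hα : 0 ≤ α) (hβ : 0 ≤ β) (hy0 : ∀ n, 0 < y n) (hy1 : ∀ n, y n < 1)
    (ha : ∀ n, 1 ≤ a n) (hya : ∀ n, (y n)⁻¹ = a n + y (n + 1)) (hx : y 0 = |x|)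
    (hsum : Summable (digitBound α β y a)) :
    Summable (fun j : ℕ =>
      (∏ l ∈ Finset.range j, |Tmap^[l] x|) ^ α / |Tmap^[j] x| ^ β) := by
  have hle : ∀ n, ∑ m ∈ Finset.range n, digitBound α β y a m ≤ ∑' m, digitBound α β y a m :=
    fun n => hsum.sum_le_tsum _ fun m _ => digitBound_nonneg hy0 m
  refine summable_of_sum_range_le (c := ∑' m, digitBound α β y a m) (fun j => by positivity)
    fun j => ?_
  obtain ⟨n, ⟨-, -, h⟩ | ⟨k, -, -, -, -, h⟩⟩ := orbit_state hα hβ hy0 hy1 ha hya hx j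
  · exact h.trans (hle n)
  · refine h.trans (le_trans ?_ (hle (n + 1)))
    rw [Finset.sum_range_succ]
    have h1 : 0 < ∏ i ∈ Finset.range n, y i := Finset.prod_pos fun i _ => hy0 i
    have h2 := hy0 n
    have h3 : 0 ≤ 2 ^ (α + β) * ((∏ i ∈ Finset.range n, y i) ^ α / y n ^ β) := by positivity
    have h4 : 0 ≤ k * (2 ^ β * (∏ i ∈ Finset.range n, y i) ^ α) := by positivity
    have h5 : digitBound α β y a n = 2 ^ β * a n * (∏ i ∈ Finset.range n, y i) ^ α
      + 2 ^ (α + β) * ((∏ i ∈ Finset.range n, y i) ^ α / y n ^ β) := rfl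
    linarith

theorem digitBound_le (hα : 0 ≤ α) (hβ : 0 ≤ β) (hy0 : ∀ n, 0 < y n) (hy1 : ∀ n, y n < 1)
    (ha : ∀ n, 1 ≤ a n) (hya : ∀ n, (y n)⁻¹ = a n + y (n + 1)) {n : ℕ} {q q' : ℝ} (hq : 0 < q)
    (hqq : a n * q ≤ q') (hR : (∏ i ∈ Finset.range n, y i) * q ≤ 1) :
    digitBound α β y a n
      ≤ (2 ^ β + 2 ^ (α + β) * 2 ^ β) * (q' ^ (β + 1) / q ^ (α + β + 1)) := by
  have hRpos : 0 < ∏ i ∈ Finset.range n, y i := Finset.prod_pos fun i _ => hy0 i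
  have ha1 : (1 : ℝ) ≤ a n := by exact_mod_cast ha n
  have hq' : 0 < q' := lt_of_lt_of_le (by positivity) hqq
  have har : (a n : ℝ) ≤ q' / q := (le_div_iff₀ hq).2 hqq
  have hr1 : 1 ≤ q' / q := ha1.trans har
  have hr : 0 < q' / q := by positivity
  have h1 : (∏ i ∈ Finset.range n, y i) ^ α ≤ (q⁻¹) ^ α := by
    gcongr
    rwa [← one_div, le_div_iff₀ hq]
  have h2 : (a n : ℝ) ≤ (q' / q) ^ (β + 1) :=
    har.trans (Real.self_le_rpow_of_one_le hr1 (by linarith))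
  have h3 : ((y n)⁻¹) ^ β ≤ 2 ^ β * (q' / q) ^ (β + 1) := by
    have h4 : (y n)⁻¹ ≤ 2 * (q' / q) := by
      rw [hya]
      linarith [hy1 (n + 1)]
    have h5 : 0 ≤ (y n)⁻¹ := inv_nonneg.2 (hy0 n).le
    calc _ ≤ (2 * (q' / q)) ^ β := by gcongr
      _ = 2 ^ β * (q' / q) ^ β := Real.mul_rpow zero_le_two hr.le
      _ ≤ _ := by
        gcongr
        linarith
  have h6 : q' ^ (β + 1) / q ^ (α + β + 1) = (q' / q) ^ (β + 1) * (q⁻¹) ^ α := by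
    rw [Real.div_rpow hq'.le hq.le, Real.inv_rpow hq.le, add_assoc, Real.rpow_add hq]
    field_simp
  have hy := hy0 n
  unfold digitBound
  rw [h6, div_eq_mul_inv _ (y n ^ β), ← Real.inv_rpow hy.le]
  calc _ ≤ 2 ^ β * (q' / q) ^ (β + 1) * (q⁻¹) ^ α
        + 2 ^ (α + β) * ((q⁻¹) ^ α * (2 ^ β * (q' / q) ^ (β + 1))) := by gcongr
    _ = _ := by ring

end Orbit

/-- The orbit of `x` under the Gauss map. -/
noncomputable def gaussOrbit (x : ℝ) (n : ℕ) : ℝ := (fun z : ℝ => Int.fract z⁻¹)^[n] x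

theorem gaussOrbit_succ (x : ℝ) (n : ℕ) :
    gaussOrbit x (n + 1) = Int.fract (gaussOrbit x n)⁻¹ :=
  Function.iterate_succ_apply' _ _ _

theorem irrational_gaussOrbit {x : ℝ} (h : Irrational x) (n : ℕ) :
    Irrational (gaussOrbit x n) := by
  induction n with
  | zero => exact h
  | succ n ih =>
    rw [gaussOrbit_succ, Int.fract]
    exact ih.inv.sub_intCast _

theorem gaussOrbit_mem_Ioo {x : ℝ} (hx : x ∈ Set.Ioo (0 : ℝ) 1) (h : Irrational x) (n : ℕ) :
    gaussOrbit x n ∈ Set.Ioo (0 : ℝ) 1 := by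
  cases n with
  | zero => exact hx
  | succ n =>
    have h1 := (irrational_gaussOrbit h (n + 1)).ne_zero
    rw [gaussOrbit_succ] at h1 ⊢
    exact ⟨lt_of_le_of_ne (Int.fract_nonneg _) h1.symm, Int.fract_lt_one _⟩

/-- The regular continued fraction digits of `x`, indexed from `0`. -/
noncomputable def gaussDigit (x : ℝ) (n : ℕ) : ℕ := ⌊(gaussOrbit x n)⁻¹⌋₊

theorem gaussDigit_eq {x : ℝ} (hx : x ∈ Set.Ioo (0 : ℝ) 1) (h : Irrational x) (n : ℕ) :
    (gaussDigit x n : ℝ) = (⌊(gaussOrbit x n)⁻¹⌋ : ℤ) :=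
  natCast_floor_eq_intCast_floor (inv_nonneg.2 (gaussOrbit_mem_Ioo hx h n).1.le)

theorem inv_gaussOrbit {x : ℝ} (hx : x ∈ Set.Ioo (0 : ℝ) 1) (h : Irrational x) (n : ℕ) :
    (gaussOrbit x n)⁻¹ = gaussDigit x n + gaussOrbit x (n + 1) := by
  rw [gaussDigit_eq hx h, gaussOrbit_succ, Int.floor_add_fract]

theorem one_le_gaussDigit {x : ℝ} (hx : x ∈ Set.Ioo (0 : ℝ) 1) (h : Irrational x) (n : ℕ) :
    1 ≤ gaussDigit x n := by
  have h1 := gaussOrbit_mem_Ioo hx h n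
  exact Nat.le_floor (by simpa using (one_le_inv₀ h1.1).2 h1.2.le)

theorem stream_eq_gaussOrbit {x : ℝ} (hx : x ∈ Set.Ioo (0 : ℝ) 1) (h : Irrational x) (n : ℕ) :
    ∃ b, GenContFract.IntFractPair.stream x n = some ⟨b, gaussOrbit x n⟩ := by
  induction n with
  | zero =>
    refine ⟨⌊x⌋, ?_⟩
    rw [GenContFract.IntFractPair.stream_zero, GenContFract.IntFractPair.of,
      Int.fract_eq_self.2 ⟨hx.1.le, hx.2⟩]
    rfl
  | succ n ih =>
    obtain ⟨b, hb⟩ := ih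
    refine ⟨⌊(gaussOrbit x n)⁻¹⌋, ?_⟩
    rw [GenContFract.IntFractPair.stream_succ_of_some hb (irrational_gaussOrbit h n).ne_zero,
      GenContFract.IntFractPair.of, gaussOrbit_succ]

theorem of_s_get?_eq {x : ℝ} (hx : x ∈ Set.Ioo (0 : ℝ) 1) (h : Irrational x) (n : ℕ) :
    (GenContFract.of x).s.get? n = some ⟨1, (gaussDigit x n : ℝ)⟩ := by
  obtain ⟨b, hb⟩ := stream_eq_gaussOrbit hx h n
  rw [GenContFract.get?_of_eq_some_of_get?_intFractPair_stream_fr_ne_zero hb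
    (irrational_gaussOrbit h n).ne_zero, gaussDigit_eq hx h]
  rfl

theorem Qden_zero (x : ℝ) : Qden x 0 = 1 := GenContFract.zeroth_den_eq_one

theorem Qden_one {x : ℝ} (hx : x ∈ Set.Ioo (0 : ℝ) 1) (h : Irrational x) :
    Qden x 1 = gaussDigit x 0 :=
  GenContFract.first_den_eq (of_s_get?_eq hx h 0)

theorem Qden_add_two {x : ℝ} (hx : x ∈ Set.Ioo (0 : ℝ) 1) (h : Irrational x) (n : ℕ) :
    Qden x (n + 2) = gaussDigit x (n + 1) * Qden x (n + 1) + Qden x n := by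
  have := GenContFract.dens_recurrence (of_s_get?_eq hx h (n + 1)) rfl rfl
  simpa [Qden] using this

theorem Qden_pos {x : ℝ} (hx : x ∈ Set.Ioo (0 : ℝ) 1) (h : Irrational x) (n : ℕ) :
    0 < Qden x n := by
  induction n using Nat.twoStepInduction with
  | zero => simp [Qden_zero]
  | one =>
    rw [Qden_one hx h]
    exact_mod_cast one_le_gaussDigit hx h 0
  | more n ih1 ih2 =>
    rw [Qden_add_two hx h]
    positivity

theorem prod_gaussOrbit_mul_Qden {x : ℝ} (hx : x ∈ Set.Ioo (0 : ℝ) 1) (h : Irrational x) (n : ℕ) :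
    (∏ i ∈ Finset.range (n + 1), gaussOrbit x i)
      * (Qden x (n + 1) + Qden x n * gaussOrbit x (n + 1)) = 1 := by
  have hmul : ∀ n, gaussOrbit x n * (gaussDigit x n + gaussOrbit x (n + 1)) = 1 := fun n => by
    rw [← inv_gaussOrbit hx h, mul_inv_cancel₀ (irrational_gaussOrbit h n).ne_zero]
  induction n with
  | zero => simpa [Qden_zero, Qden_one hx h] using hmul 0
  | succ n ih =>
    rw [Finset.prod_range_succ, Qden_add_two hx h]
    linear_combination ih +
      (∏ i ∈ Finset.range (n + 1), gaussOrbit x i) * Qden x (n + 1) * hmul (n + 1)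

theorem prod_gaussOrbit_mul_Qden_le {x : ℝ} (hx : x ∈ Set.Ioo (0 : ℝ) 1) (h : Irrational x)
    (n : ℕ) : (∏ i ∈ Finset.range (n + 1), gaussOrbit x i) * Qden x (n + 1) ≤ 1 := by
  have h1 : 0 < ∏ i ∈ Finset.range (n + 1), gaussOrbit x i :=
    Finset.prod_pos fun i _ => (gaussOrbit_mem_Ioo hx h i).1
  rw [← prod_gaussOrbit_mul_Qden hx h n]
  have h2 := Qden_pos hx h n
  have h3 := (gaussOrbit_mem_Ioo hx h (n + 1)).1
  gcongr
  exact le_add_of_nonneg_right (by positivity)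

/-- convergence of `Σ (Π|T^ℓx|)^α / |T^j x|^β` for `0 ≤ β < β_α` under
`Σ Q_{n+1}^{β+1}/Q_n^{α+β+1} < ∞`. -/
theorem stmt12 (α β : ℝ) (hα : 0 < α) (hβ0 : 0 ≤ β)
    (hβ : β < (Real.sqrt (α ^ 2 + 4) - 1) / 2)
    (x : ℝ) (hx : x ∈ Set.Ioo (0 : ℝ) 1) (hirr : Irrational x)
    (hsum : Summable (fun n : ℕ =>
      Qden x (n + 2) ^ (β + 1) / Qden x (n + 1) ^ (α + β + 1))) :
    Summable (fun j : ℕ =>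
      (∏ ℓ ∈ Finset.range j, |Tmap^[ℓ] x|) ^ α / |Tmap^[j] x| ^ β) := by
  have hy0 := fun n => (gaussOrbit_mem_Ioo hx hirr n).1
  have hy1 := fun n => (gaussOrbit_mem_Ioo hx hirr n).2
  have ha := one_le_gaussDigit hx hirr
  have hya := inv_gaussOrbit hx hirr
  refine summable_orbit hα.le hβ0 hy0 hy1 ha hya (abs_of_pos hx.1).symm ?_
  rw [← summable_nat_add_iff 1]
  refine Summable.of_nonneg_of_le (fun n => digitBound_nonneg hy0 _) (fun n => ?_)
    (hsum.mul_left (2 ^ β + 2 ^ (α + β) * 2 ^ β))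
  refine digitBound_le hα.le hβ0 hy0 hy1 ha hya (Qden_pos hx hirr _) ?_
    (prod_gaussOrbit_mul_Qden_le hx hirr n)
  rw [Qden_add_two hx hirr]
  exact le_add_of_nonneg_right (Qden_pos hx hirr n).le
end
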